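/- arXiv:1901.02135 — 2 statements merged into one kernel-verified Lean document; each statement's English description precedes it below -/
import Mathlib

section
/- (Brin–Katok formula for flows, non-ergodic case.) Let (X,d) be a compact metric space, φ a continuous flow on X without fixed points, and μ a φ-invariant Borel probability measure. Then ∫_X underline h_μ(φ,x) dμ(x) = ∫_X overline h_μ(φ,x) dμ(x) = h_μ(φ₁), and for μ-almost every x∈X one has overline h_μ(φ,x) = underline h_μ(φ,x). -/
open MeasureTheory Filter Set Topology
open scoped ENNReal NNReal

namespace FlowEntropy

variable {X : Type*}

/-- A continuous flow on `X`. -/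
structure IsFlow [TopologicalSpace X] (φ : ℝ → X → X) : Prop where
  cont : Continuous fun p : ℝ × X => φ p.1 p.2
  map_zero : ∀ x, φ 0 x = x
  map_add : ∀ s t : ℝ, ∀ x, φ (s + t) x = φ s (φ t x)

/-- The flow has no fixed points. -/
def FixedPointFree (φ : ℝ → X → X) : Prop :=
  ∀ x : X, ∃ t : ℝ, φ t x ≠ x

/-- The measure `μ` is invariant under every time-`t` map of the flow. -/
def FlowInvariant [MeasurableSpace X] (φ : ℝ → X → X) (μ : Measure X) : Prop :=
  ∀ t : ℝ, MeasurePreserving (φ t) μ μ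

/-- The measure `μ` is invariant and ergodic for the flow: every Borel set invariant
under all time-`t` maps has measure `0` or `1`. -/
def FlowErgodic [MeasurableSpace X] (φ : ℝ → X → X) (μ : Measure X) : Prop :=
  FlowInvariant φ μ ∧
    ∀ B : Set X, MeasurableSet B → (∀ t : ℝ, φ t ⁻¹' B = B) → μ B = 0 ∨ μ B = 1

/-- `α` is a reparametrization on the closed interval `I` (containing the origin):
a continuous map that is a homeomorphism onto its image (equivalently, continuous and
injective on the compact interval), fixing the origin. -/
def IsReparOn (α : ℝ → ℝ) (I : Set ℝ) : Prop :=
  ContinuousOn α I ∧ Set.InjOn α I ∧ α 0 = 0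

/-- The reparametrization ball `B(x, t, ε, φ)`. -/
def reparBall [PseudoMetricSpace X] (φ : ℝ → X → X) (x : X) (t ε : ℝ) : Set X :=
  {y : X | ∃ α : ℝ → ℝ, IsReparOn α (Set.Icc 0 t) ∧
      ∀ s ∈ Set.Icc (0 : ℝ) t, dist (φ (α s) x) (φ s y) < ε}

/-- `M^s_{N,ε}(φ, Z)`: infimum of `Σ_i exp (-s t_i)` over countable families of
reparametrization balls `B(x_i, t_i, ε, φ)` with `t_i ≥ N` covering `Z`. -/
noncomputable def coverM [PseudoMetricSpace X] (φ : ℝ → X → X) (Z : Set X) (s : ℝ) (N : ℕ)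
    (ε : ℝ) : ℝ≥0∞ :=
  ⨅ (F : Set (X × ℝ)) (_ : F.Countable) (_ : ∀ p ∈ F, (N : ℝ) ≤ p.2)
    (_ : Z ⊆ ⋃ p ∈ F, reparBall φ p.1 p.2 ε),
    ∑' p : F, ENNReal.ofReal (Real.exp (-s * (p : X × ℝ).2))

/-- `M^s_ε(φ, Z) = lim_{N → ∞} M^s_{N,ε}(φ, Z)` (an increasing limit). -/
noncomputable def coverMeps [PseudoMetricSpace X] (φ : ℝ → X → X) (Z : Set X) (s ε : ℝ) :
    ℝ≥0∞ :=
  ⨆ N : ℕ, coverM φ Z s N ε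

/-- `M^s(φ, Z) = lim_{ε → 0} M^s_ε(φ, Z)` (an increasing limit as `ε` decreases). -/
noncomputable def coverMlim [PseudoMetricSpace X] (φ : ℝ → X → X) (Z : Set X) (s : ℝ) :
    ℝ≥0∞ :=
  ⨆ (ε : ℝ) (_ : 0 < ε), coverMeps φ Z s ε

/-- The Bowen entropy `h_top^B(φ, Z)`: the critical value where `M^s(φ,Z)` jumps
from `∞` to `0` (as an extended nonnegative real; `⊤` if no finite critical value). -/
noncomputable def bowenEntropy [PseudoMetricSpace X] (φ : ℝ → X → X) (Z : Set X) : ℝ≥0∞ :=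
  ⨅ (s : ℝ) (_ : 0 ≤ s) (_ : coverMlim φ Z s = 0), ENNReal.ofReal s

/-- Static entropy of a finite measurable partition, encoded as a map into a finite type. -/
noncomputable def partEnt [MeasurableSpace X] (μ : Measure X) {ι : Type*} [Fintype ι]
    (P : X → ι) : ℝ :=
  ∑ i : ι, Real.negMulLog ((μ (P ⁻¹' {i})).toReal)

/-- The measure-theoretic (Kolmogorov–Sinai) entropy of a map `T` with respect to `μ`:
the supremum over finite measurable partitions of the asymptotic entropy per unit time of
the dynamical refinements. -/
noncomputable def kolSinai [MeasurableSpace X] (μ : Measure X) (T : X → X) : ℝ≥0∞ :=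
  ⨆ (k : ℕ) (P : X → Fin k) (_ : Measurable P),
    Filter.limsup (fun n : ℕ =>
      ENNReal.ofReal (partEnt μ (fun x => fun j : Fin n => P (T^[(j : ℕ)] x)) / n))
      Filter.atTop

/-- `-log a` as a member of `ℝ≥0∞`, for `a ∈ [0,1]` (with `-log 0 = ∞`). -/
noncomputable def negLogNN (a : ℝ≥0∞) : ℝ≥0∞ :=
  if a = 0 then ⊤ else ENNReal.ofReal (-Real.log a.toReal)

/-- `-(1/t) log μ(B(x,t,ε,φ))`, as a member of `ℝ≥0∞`. -/
noncomputable def localRate [PseudoMetricSpace X] [MeasurableSpace X] (μ : Measure X)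
    (φ : ℝ → X → X) (x : X) (ε t : ℝ) : ℝ≥0∞ :=
  negLogNN (μ (reparBall φ x t ε)) / ENNReal.ofReal t

/-- The lower local entropy `underline h_μ(φ, x) = lim_{ε→0} liminf_{t→∞}
  -(1/t) log μ(B(x,t,ε,φ))` (the limit in `ε` is an increasing limit, hence a supremum). -/
noncomputable def lowerLocalEnt [PseudoMetricSpace X] [MeasurableSpace X] (μ : Measure X)
    (φ : ℝ → X → X) (x : X) : ℝ≥0∞ :=
  ⨆ (ε : ℝ) (_ : 0 < ε), Filter.liminf (fun t : ℝ => localRate μ φ x ε t) Filter.atTop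

/-- The upper local entropy `overline h_μ(φ, x) = lim_{ε→0} limsup_{t→∞}
  -(1/t) log μ(B(x,t,ε,φ))`. -/
noncomputable def upperLocalEnt [PseudoMetricSpace X] [MeasurableSpace X] (μ : Measure X)
    (φ : ℝ → X → X) (x : X) : ℝ≥0∞ :=
  ⨆ (ε : ℝ) (_ : 0 < ε), Filter.limsup (fun t : ℝ => localRate μ φ x ε t) Filter.atTop

/-- The set `G_μ(φ)` of generic points of `μ` for the flow `φ`. -/
def genericPts [TopologicalSpace X] [MeasurableSpace X] (φ : ℝ → X → X) (μ : Measure X) :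
    Set X :=
  {x : X | ∀ f : C(X, ℝ),
    Filter.Tendsto (fun t : ℝ => (1 / t) * ∫ τ in (0 : ℝ)..t, f (φ τ x))
      Filter.atTop (nhds (∫ y, f y ∂μ))}

/-- The weight `exp (-c)` as an extended nonnegative real. -/
noncomputable def expNeg (c : ℝ) : ℝ≥0∞ := ENNReal.ofReal (Real.exp (-c))

theorem expNeg_add (c d : ℝ) : expNeg (c + d) = expNeg c * expNeg d := by
  rw [expNeg, expNeg, expNeg, ← ENNReal.ofReal_mul (Real.exp_pos _).le, ← Real.exp_add, neg_add]

theorem expNeg_anti {c d : ℝ} (h : c ≤ d) : expNeg d ≤ expNeg c :=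
  ENNReal.ofReal_le_ofReal (Real.exp_le_exp.2 (neg_le_neg h))

@[simp] theorem expNeg_zero : expNeg 0 = 1 := by simp [expNeg]

theorem expNeg_pos (c : ℝ) : 0 < expNeg c := ENNReal.ofReal_pos.2 (Real.exp_pos _)

theorem summable_expNeg {κ : ℝ} (hκ : 0 < κ) : ∑' n : ℕ, expNeg (κ * n) ≠ ⊤ := by
  have h : Summable fun n : ℕ => Real.exp (-(κ * n)) := by
    have := Real.summable_exp_nat_mul_iff.2 (neg_neg_of_pos hκ)
    refine this.congr fun n => by congr 1; ring
  exact h.tsum_ofReal_ne_top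

/-- The sum of `f` over all words of length `n`. -/
noncomputable def wordSum {A : Type*} [Fintype A] (n : ℕ) (f : List A → ℝ≥0∞) : ℝ≥0∞ :=
  ∑ w : Fin n → A, f (List.ofFn w)

section Words

variable {A : Type*} [Fintype A]

@[simp] theorem wordSum_zero (f : List A → ℝ≥0∞) : wordSum 0 f = f [] := by
  simp [wordSum]

theorem wordSum_succ (n : ℕ) (f : List A → ℝ≥0∞) :
    wordSum (n + 1) f = ∑ a : A, wordSum n fun u => f (a :: u) := by
  unfold wordSum
  rw [← (Fin.consEquiv fun _ => A).sum_comp, Fintype.sum_prod_type]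
  simp [Fin.consEquiv, List.ofFn_succ]

theorem wordSum_add (m n : ℕ) (f : List A → ℝ≥0∞) :
    wordSum (m + n) f = wordSum m fun u => wordSum n fun v => f (u ++ v) := by
  induction m generalizing f with
  | zero => simp
  | succ m ih =>
    rw [Nat.add_right_comm, wordSum_succ, wordSum_succ]
    simp [ih]

theorem wordSum_congr {n : ℕ} {f g : List A → ℝ≥0∞} (h : ∀ u, u.length = n → f u = g u) :
    wordSum n f = wordSum n g :=
  Finset.sum_congr rfl fun w _ => h _ (by simp)

theorem wordSum_mono {n : ℕ} {f g : List A → ℝ≥0∞} (h : ∀ u, u.length = n → f u ≤ g u) :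
    wordSum n f ≤ wordSum n g :=
  Finset.sum_le_sum fun w _ => h _ (by simp)

theorem wordSum_mul_left (n : ℕ) (c : ℝ≥0∞) (f : List A → ℝ≥0∞) :
    wordSum n (fun u => c * f u) = c * wordSum n f := by
  simp [wordSum, Finset.mul_sum]

theorem wordSum_finset_sum {ι : Type*} (n : ℕ) (s : Finset ι) (f : ι → List A → ℝ≥0∞) :
    wordSum n (fun u => ∑ i ∈ s, f i u) = ∑ i ∈ s, wordSum n (f i) :=
  Finset.sum_comm

theorem wordSum_add_fun (n : ℕ) (f g : List A → ℝ≥0∞) :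
    wordSum n (fun u => f u + g u) = wordSum n f + wordSum n g :=
  Finset.sum_add_distrib

theorem sum_lintegral_le [MeasurableSpace X] (μ : Measure X) {ι : Type*} (s : Finset ι)
    (f : ι → X → ℝ≥0∞) : ∑ i ∈ s, ∫⁻ x, f i x ∂μ ≤ ∫⁻ x, ∑ i ∈ s, f i x ∂μ := by
  classical
  induction s using Finset.induction_on with
  | empty => simp
  | insert i s hi ih =>
    simp only [Finset.sum_insert hi]
    exact (add_le_add le_rfl ih).trans (le_lintegral_add _ _)

/-- The total weight of all ways to write a word as a concatenation of blocks, where `b` gives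
the weights of the blocks. -/
noncomputable def tilingWeightAux (b : List A → ℝ≥0∞) : ℕ → List A → ℝ≥0∞
  | 0, _ => 1
  | n + 1, l => ∑ m ∈ Finset.range (n + 1),
      b (l.take (m + 1)) * tilingWeightAux b (n - m) (l.drop (m + 1))
termination_by n => n
decreasing_by omega

/-- A subprobability on words which is supermultiplicative with respect to the block
weights `b`. -/
theorem exists_tiling_weight (b : List A → ℝ≥0∞)
    (hb : ∀ n, ∑ m ∈ Finset.range n, wordSum (m + 1) b ≤ 1) :
    ∃ Q : List A → ℝ≥0∞, (∀ n, wordSum n Q ≤ 1) ∧ Q [] = 1 ∧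
      ∀ u v, u ≠ [] → b u * Q v ≤ Q (u ++ v) := by
  refine ⟨fun l => tilingWeightAux b l.length l, ?_, ?_, ?_⟩
  · have key : ∀ n, wordSum n (tilingWeightAux b n) ≤ 1 := by
      intro n
      induction n using Nat.strong_induction_on with
      | _ n ih =>
        cases n with
        | zero => simp [tilingWeightAux]
        | succ n =>
          have h : ∀ m ∈ Finset.range (n + 1), wordSum (n + 1) (fun l : List A =>
              b (l.take (m + 1)) * tilingWeightAux b (n - m) (l.drop (m + 1)))
              ≤ wordSum (m + 1) b := by
            intro m hm
            have hm' : n + 1 = (m + 1) + (n - m) := by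
              have := Finset.mem_range.1 hm
              omega
            rw [hm', wordSum_add]
            have : ∀ u : List A, u.length = m + 1 → (wordSum (n - m) fun v =>
                b ((u ++ v).take (m + 1)) * tilingWeightAux b (n - m) ((u ++ v).drop (m + 1)))
                ≤ b u := by
              intro u hu
              have : (wordSum (n - m) fun v =>
                b ((u ++ v).take (m + 1)) * tilingWeightAux b (n - m) ((u ++ v).drop (m + 1)))
                = wordSum (n - m) fun v => b u * tilingWeightAux b (n - m) v := by
                refine wordSum_congr fun v _ => ?_
                rw [← hu, List.take_left, List.drop_left]
              rw [this, wordSum_mul_left]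
              exact mul_le_of_le_one_right' (ih (n - m) (by omega))
            exact wordSum_mono this
          have h2 : wordSum (n + 1) (tilingWeightAux b (n + 1)) =
              ∑ m ∈ Finset.range (n + 1), wordSum (n + 1) (fun l : List A =>
              b (l.take (m + 1)) * tilingWeightAux b (n - m) (l.drop (m + 1))) := by
            rw [← wordSum_finset_sum]
            refine wordSum_congr fun u _ => ?_
            rw [tilingWeightAux]
          rw [h2]
          exact (Finset.sum_le_sum h).trans (hb _)
    intro n
    refine le_of_eq_of_le (wordSum_congr fun u hu => ?_) (key n)
    simp only [hu]
  · simp [tilingWeightAux]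
  · intro u v hu
    obtain ⟨m, hm⟩ : ∃ m, u.length = m + 1 :=
      Nat.exists_eq_succ_of_ne_zero (by simpa using hu)
    have hl : (u ++ v).length = (m + v.length) + 1 := by
      rw [List.length_append]; omega
    change _ ≤ tilingWeightAux b (u ++ v).length (u ++ v)
    rw [hl, tilingWeightAux]
    refine le_trans (le_of_eq ?_) (Finset.single_le_sum
      (f := fun i => b ((u ++ v).take (i + 1)) *
        tilingWeightAux b (m + v.length - i) ((u ++ v).drop (i + 1)))
      (fun _ _ => zero_le) (Finset.mem_range.2 (show m < m + v.length + 1 by omega)))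
    simp only [← hm, List.take_left, List.drop_left]
    congr 2
    omega

/-- The likelihood of a word under a hidden Markov model: the hidden state is an integer shift `g`
which stays with weight `p`, moves by one step with weight `q`, and emits the letter `a` with
weight `e g z a` while `z` moves along the orbit of `T`. -/
noncomputable def hiddenWeight (T : X → X) (e : ℤ → X → A → ℝ≥0∞) (p q : ℝ≥0∞) :
    List A → ℤ → X → ℝ≥0∞
  | [], _, _ => 1
  | a :: u, g, z => e g z a * (p * hiddenWeight T e p q u g (T z) +
      q * hiddenWeight T e p q u (g + 1) (T z) + q * hiddenWeight T e p q u (g - 1) (T z))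

theorem wordSum_hiddenWeight_le (T : X → X) (e : ℤ → X → A → ℝ≥0∞) (p q : ℝ≥0∞)
    (he : ∀ g z, ∑ a, e g z a ≤ 1) (hpq : p + q + q ≤ 1) (n : ℕ) (g : ℤ) (z : X) :
    wordSum n (fun u => hiddenWeight T e p q u g z) ≤ 1 := by
  induction n generalizing g z with
  | zero => simp [hiddenWeight]
  | succ n ih =>
    rw [wordSum_succ]
    simp only [hiddenWeight, wordSum_mul_left, wordSum_add_fun]
    rw [← Finset.sum_mul]
    refine mul_le_one' (he g z) (le_trans ?_ hpq)
    gcongr <;> exact mul_le_of_le_one_right' (ih _ _)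

end Words

/-- The word of length `n` read off by the partition `P` along the orbit of `x`. -/
def word {A : Type*} (T : X → X) (P : X → A) : ℕ → X → List A
  | 0, _ => []
  | n + 1, x => P x :: word T P n (T x)

section Word

variable {A : Type*} (T : X → X) (P : X → A)

@[simp] theorem length_word (n : ℕ) (x : X) : (word T P n x).length = n := by
  induction n generalizing x with
  | zero => rfl
  | succ n ih => simp [word, ih]

theorem word_add (m n : ℕ) (x : X) :
    word T P (m + n) x = word T P m x ++ word T P n (T^[m] x) := by
  induction m generalizing x with
  | zero => simp [word]
  | succ m ih => rw [Nat.add_right_comm]; simp [word, ih]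

/-- The itinerary of length `n` of `x` with respect to the partition `P`. -/
def itin (n : ℕ) (x : X) : Fin n → A := fun j => P (T^[(j : ℕ)] x)

theorem ofFn_itin (n : ℕ) (x : X) : List.ofFn (itin T P n x) = word T P n x := by
  induction n generalizing x with
  | zero => simp [word]
  | succ n ih => rw [List.ofFn_succ, word, ← ih]; rfl

/-- The points sharing the itinerary of length `n` of `x`. -/
def cyl (n : ℕ) (x : X) : Set X := itin T P n ⁻¹' {itin T P n x}

end Word

section Coding

variable [MeasurableSpace X] {k : ℕ} {T : X → X} {P : X → Fin k}

theorem measurable_itin (hT : Measurable T) (hP : Measurable P) (n : ℕ) :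
    Measurable (itin T P n) :=
  measurable_pi_lambda _ fun j => hP.comp (hT.iterate j)

/-- A subprobability on words cannot exceed the measure of cylinders by an exponential factor. -/
theorem ae_eventually_weight_le (μ : Measure X) (Q : List (Fin k) → ℝ≥0∞)
    (hQ : ∀ n, wordSum n Q ≤ 1) {κ : ℝ} (hκ : 0 < κ) :
    ∀ᵐ x ∂μ, ∀ᶠ n : ℕ in atTop, expNeg (κ * n) * Q (word T P n x) ≤ μ (cyl T P n x) := by
  have h : ∀ n : ℕ, μ {x | μ (cyl T P n x) < expNeg (κ * n) * Q (word T P n x)}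
      ≤ expNeg (κ * n) := by
    intro n
    set s : Set X := {x | μ (cyl T P n x) < expNeg (κ * n) * Q (word T P n x)}
    have hs : s ⊆ ⋃ w : Fin n → Fin k, s ∩ itin T P n ⁻¹' {w} := fun x hx =>
      mem_iUnion.2 ⟨itin T P n x, hx, rfl⟩
    calc μ s ≤ ∑ w : Fin n → Fin k, μ (s ∩ itin T P n ⁻¹' {w}) := by
          refine (measure_mono hs).trans ((measure_iUnion_le _).trans ?_)
          rw [tsum_fintype]
      _ ≤ ∑ w : Fin n → Fin k, expNeg (κ * n) * Q (List.ofFn w) := by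
          refine Finset.sum_le_sum fun w _ => ?_
          rcases (s ∩ itin T P n ⁻¹' {w}).eq_empty_or_nonempty with h | ⟨x, hx, hxw⟩
          · simp [h]
          · have hxw : itin T P n x = w := hxw
            refine (measure_mono inter_subset_right).trans ?_
            have := le_of_lt (show μ (cyl T P n x) < _ from hx)
            rwa [cyl, ← ofFn_itin, hxw] at this
      _ = expNeg (κ * n) * wordSum n Q := by rw [wordSum, Finset.mul_sum]
      _ ≤ expNeg (κ * n) := mul_le_of_le_one_right' (hQ n)
  have h2 : ∑' n : ℕ, μ {x | μ (cyl T P n x) < expNeg (κ * n) * Q (word T P n x)} ≠ ⊤ :=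
    ne_top_of_le_ne_top (summable_expNeg hκ) (ENNReal.tsum_le_tsum h)
  filter_upwards [ae_eventually_notMem h2] with x hx
  filter_upwards [hx] with n hn
  simpa using hn

end Coding

theorem negLogNN_anti {p q : ℝ≥0∞} (h : p ≤ q) (hq : q ≠ ⊤) : negLogNN q ≤ negLogNN p := by
  unfold negLogNN
  by_cases hp : p = 0
  · simp [hp]
  have hq0 : q ≠ 0 := fun h0 => hp (le_antisymm (h0 ▸ h) zero_le)
  rw [if_neg hp, if_neg hq0]
  refine ENNReal.ofReal_le_ofReal (neg_le_neg (Real.log_le_log ?_ ?_))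
  · exact ENNReal.toReal_pos hp (ne_top_of_le_ne_top hq h)
  · exact ENNReal.toReal_mono hq h

theorem negLogNN_expNeg (r : ℝ) : negLogNN (expNeg r) = ENNReal.ofReal r := by
  rw [negLogNN, if_neg (expNeg_pos r).ne', expNeg, ENNReal.toReal_ofReal (Real.exp_pos _).le,
    Real.log_exp, neg_neg]

theorem expNeg_le_of_negLogNN_le {p : ℝ≥0∞} (hp : p ≠ ⊤) {r : ℝ} (hr : 0 ≤ r)
    (h : negLogNN p ≤ ENNReal.ofReal r) :
    expNeg r ≤ p := by
  unfold negLogNN at h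
  split_ifs at h with h0
  · exact absurd (top_le_iff.1 h) ENNReal.ofReal_ne_top
  · have h1 : -Real.log p.toReal ≤ r := (ENNReal.ofReal_le_ofReal_iff hr).1 h
    have hpos := ENNReal.toReal_pos h0 hp
    rw [expNeg, ENNReal.ofReal_le_iff_le_toReal hp, ← Real.le_log_iff_exp_le hpos]
    linarith

/-- The number of visits of the orbit segment `x, …, T^(n-1) x` to `E`. -/
noncomputable def visits (T : X → X) (E : Set X) (n : ℕ) (x : X) : ℝ :=
  birkhoffSum T (E.indicator fun _ => (1 : ℝ)) n x

section Visits

variable (T : X → X) (E : Set X)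

theorem visits_zero (x : X) : visits T E 0 x = 0 := birkhoffSum_zero _ _ _

theorem visits_succ (n : ℕ) (x : X) :
    visits T E (n + 1) x = E.indicator (fun _ => (1 : ℝ)) x + visits T E n (T x) :=
  birkhoffSum_succ' _ _ _ _

theorem visits_add (m n : ℕ) (x : X) :
    visits T E (m + n) x = visits T E m x + visits T E n (T^[m] x) :=
  birkhoffSum_add _ _ _ _ _

theorem visits_nonneg (n : ℕ) (x : X) : 0 ≤ visits T E n x := by
  unfold visits birkhoffSum
  exact Finset.sum_nonneg fun _ _ => indicator_nonneg (fun _ _ => zero_le_one) _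

theorem visits_le (n : ℕ) (x : X) : visits T E n x ≤ n := by
  unfold visits birkhoffSum
  refine (Finset.sum_le_card_nsmul _ _ 1 fun j _ => ?_).trans (by simp)
  exact indicator_le_self' (fun _ _ => zero_le_one) _

theorem integral_visits [MeasurableSpace X] {μ : Measure X} [IsProbabilityMeasure μ] {T : X → X}
    (hT : MeasurePreserving T μ μ) {E : Set X} (hE : MeasurableSet E) (n : ℕ) :
    Integrable (visits T E n) μ ∧ ∫ x, visits T E n x ∂μ = n * μ.real E := by
  have hm : Measurable (E.indicator fun _ => (1 : ℝ)) := measurable_const.indicator hE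
  have hi : Integrable (E.indicator fun _ => (1 : ℝ)) μ := (integrable_const _).indicator hE
  have hj : ∀ j : ℕ, Integrable (fun x => E.indicator (fun _ => (1 : ℝ)) (T^[j] x)) μ := fun j =>
    (hT.iterate j).integrable_comp_of_integrable hi
  have hind : ∀ j : ℕ, ∫ x, E.indicator (fun _ => (1 : ℝ)) (T^[j] x) ∂μ = μ.real E := fun j => by
    have h1 : ∀ x, E.indicator (fun _ => (1 : ℝ)) (T^[j] x)
        = (T^[j] ⁻¹' E).indicator (fun _ => (1 : ℝ)) x := fun x => rfl
    simp_rw [h1]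
    rw [integral_indicator ((hT.iterate j).measurable hE)]
    simp [(hT.iterate j).measureReal_preimage hE.nullMeasurableSet]
  unfold visits birkhoffSum
  constructor
  · exact integrable_finsetSum _ fun j _ => hj j
  · rw [integral_finsetSum _ fun j _ => hj j]
    simp [hind]

/-- The covering argument behind the maximal ergodic inequality. -/
theorem mul_visits_le (r : ℝ) (hr : 0 ≤ r) (N : ℕ) (R : ℕ) (x : X) :
    r * visits T {x | ∃ n, 1 ≤ n ∧ n ≤ N ∧ r * n < visits T E n x} R x
      ≤ visits T E (R + N) x := by
  set M := {x | ∃ n, 1 ≤ n ∧ n ≤ N ∧ r * n < visits T E n x}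
  induction R using Nat.strong_induction_on generalizing x with
  | _ R ih =>
    by_cases hR : R = 0
    · subst hR
      rw [visits_zero, mul_zero]
      exact visits_nonneg _ _ _ _
    by_cases hx : x ∈ M
    · obtain ⟨n, hn1, hnN, hn⟩ := hx
      by_cases hnR : n ≤ R
      · have h1 := ih (R - n) (by omega) (T^[n] x)
        have h2 := visits_add T M n (R - n) x
        have h3 := visits_add T E n (R - n + N) x
        rw [show n + (R - n) = R by omega] at h2
        rw [show n + (R - n + N) = R + N by omega] at h3
        rw [h2, h3, mul_add]
        have := mul_le_mul_of_nonneg_left (visits_le T M n x) hr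
        linarith
      · have h1 := mul_le_mul_of_nonneg_left (visits_le T M R x) hr
        have h2 : r * (R : ℝ) ≤ r * n := by
          have : (R : ℝ) ≤ n := by exact_mod_cast (not_le.1 hnR).le
          gcongr
        have h3 := visits_add T E n (R + N - n) x
        rw [show n + (R + N - n) = R + N by omega] at h3
        have := visits_nonneg T E (R + N - n) (T^[n] x)
        linarith
    · obtain ⟨R, rfl⟩ := Nat.exists_eq_succ_of_ne_zero hR
      have h1 := ih R (by omega) (T x)
      rw [Nat.succ_eq_add_one, visits_succ, indicator_of_notMem hx, zero_add, Nat.add_right_comm,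
        visits_succ]
      have : 0 ≤ E.indicator (fun _ => (1 : ℝ)) x := indicator_nonneg (fun _ _ => zero_le_one) _
      linarith

end Visits

/-- The maximal ergodic inequality for visits to a set. -/
theorem maximal_visits [MeasurableSpace X] {μ : Measure X} [IsProbabilityMeasure μ] {T : X → X}
    (hT : MeasurePreserving T μ μ) {E : Set X} (hE : MeasurableSet E) {r : ℝ} (hr : 0 < r) :
    μ {x | ∃ n : ℕ, 1 ≤ n ∧ r * n < visits T E n x} ≤ ENNReal.ofReal (μ.real E / r) := by
  set M : ℕ → Set X := fun N => {x | ∃ n, 1 ≤ n ∧ n ≤ N ∧ r * n < visits T E n x} with hM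
  have hvm : ∀ n, Measurable (visits T E n) := fun n => by
    unfold visits birkhoffSum
    exact Finset.measurable_sum _ fun j _ =>
      (measurable_const.indicator hE).comp (hT.measurable.iterate j)
  have hMm : ∀ N, MeasurableSet (M N) := by
    intro N
    have : M N = ⋃ n, ⋃ (_ : 1 ≤ n), ⋃ (_ : n ≤ N), {x | r * n < visits T E n x} := by
      ext x
      simp only [hM, mem_ofPred_eq, mem_iUnion, exists_prop]
    rw [this]
    exact .iUnion fun n => .iUnion fun _ => .iUnion fun _ =>
      measurableSet_lt measurable_const (hvm n)
  have hbound : ∀ N, μ.real (M N) ≤ μ.real E / r := by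
    intro N
    have h : ∀ R : ℕ, r * (R * μ.real (M N)) ≤ (R + N) * μ.real E := by
      intro R
      have h1 := integral_visits hT (hMm N) R
      have h2 := integral_visits hT hE (R + N)
      rw [← h1.2]
      have := integral_mono (h1.1.const_mul r) h2.1 (fun x => mul_visits_le T E r hr.le N R x)
      rw [integral_const_mul, h2.2] at this
      push_cast at this
      exact this
    rw [le_div_iff₀ hr]
    by_contra! hlt
    obtain ⟨R, hR⟩ := exists_nat_gt (N * μ.real E / (μ.real (M N) * r - μ.real E))
    rw [div_lt_iff₀ (by linarith)] at hR
    have := h R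
    nlinarith
  have hU : {x | ∃ n : ℕ, 1 ≤ n ∧ r * n < visits T E n x} = ⋃ N, M N := by
    ext x
    simp only [hM, mem_ofPred_eq, mem_iUnion]
    exact ⟨fun ⟨n, h1, h2⟩ => ⟨n, n, h1, le_rfl, h2⟩, fun ⟨_, n, h1, _, h2⟩ => ⟨n, h1, h2⟩⟩
  have hmono : Monotone M := fun a b hab x ⟨n, h1, h2, h3⟩ => ⟨n, h1, h2.trans hab, h3⟩
  rw [hU, hmono.measure_iUnion]
  refine iSup_le fun N => ?_
  rw [← ENNReal.ofReal_toReal (measure_ne_top μ (M N))]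
  exact ENNReal.ofReal_le_ofReal (hbound N)

section Tiling

variable {k : ℕ} {T : X → X} {P : X → Fin k}

theorem expNeg_le_hiddenWeight {e : ℤ → X → Fin k → ℝ≥0∞} {θ K : ℝ} {E : Set X} (m : ℕ)
    (g : ℕ → ℤ) (x y : X) (hg : ∀ j, |g (j + 1) - g j| ≤ 1)
    (he : ∀ j < m, expNeg (θ + K * E.indicator (fun _ => (1 : ℝ)) (T^[j] x))
      ≤ e (g j) (T^[j] y) (P (T^[j] x))) (hθ : 0 ≤ θ) :
    expNeg (2 * θ * m + K * (∑ j ∈ Finset.range m, if g (j + 1) = g j then (0 : ℝ) else 1) +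
      K * visits T E m x) ≤ hiddenWeight T e (expNeg θ) (expNeg K) (word T P m x) (g 0) y := by
  induction m generalizing g x y with
  | zero => simp [hiddenWeight, word, visits_zero]
  | succ m ih =>
    have h0 := he 0 (Nat.succ_pos m)
    have h1 := ih (fun j => g (j + 1)) (T x) (T y) (fun j => hg (j + 1))
      (fun j hj => he (j + 1) (Nat.succ_lt_succ hj))
    rw [visits_succ, Finset.sum_range_succ', word, hiddenWeight]
    set c : ℝ := if g (0 + 1) = g 0 then (0 : ℝ) else 1 with hc
    set V := visits T E m (T x)
    set S := ∑ j ∈ Finset.range m, if g (j + 1 + 1) = g (j + 1) then (0 : ℝ) else 1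
    simp only [Function.iterate_zero, id_eq] at h0
    set i := E.indicator (fun _ => (1 : ℝ)) x
    have h2 : expNeg (2 * θ * (m + 1 : ℕ) + K * (S + c) + K * (i + V)) =
        expNeg (θ + K * i) * (expNeg (θ + K * c) * expNeg (2 * θ * m + K * S + K * V)) := by
      rw [← expNeg_add, ← expNeg_add]
      push_cast
      ring_nf
    rw [h2]
    refine mul_le_mul' h0 ?_
    have h3 : expNeg (θ + K * c) ≤ expNeg K ∨ g (0 + 1) = g 0 := by
      by_cases h : g (0 + 1) = g 0
      · exact Or.inr h
      · left
        rw [hc, if_neg h]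
        exact expNeg_anti (by linarith)
    have hstep := hg 0
    have : g (0 + 1) = g 0 ∨ g (0 + 1) = g 0 + 1 ∨ g (0 + 1) = g 0 - 1 := by
      rw [abs_le] at hstep; omega
    rcases this with h | h | h
    · have hc0 : c = 0 := by rw [hc, if_pos h]
      rw [hc0, mul_zero, add_zero]
      refine le_trans (mul_le_mul' le_rfl h1) ?_
      simp only [h]
      exact le_self_add.trans le_self_add
    · have h3' := h3.resolve_right (by omega)
      refine le_trans (mul_le_mul' h3' h1) ?_
      simp only [h]
      exact le_add_self.trans le_self_add
    · have h3' := h3.resolve_right (by omega)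
      refine le_trans (mul_le_mul' h3' h1) ?_
      simp only [h]
      exact le_add_self

theorem expNeg_le_tiling {b Q : List (Fin k) → ℝ≥0∞} (hQ0 : Q [] = 1)
    (hQ : ∀ u v, u ≠ [] → b u * Q v ≤ Q (u ++ v)) {D E : Set X} {G : ℕ → Set X} {N : ℕ}
    {A K : ℝ} (hA : 0 ≤ A) (hK : 0 ≤ K) (hD : MapsTo T D D) (hsingle : ∀ a, expNeg K ≤ b [a])
    (hblock : ∀ m, ∀ x ∈ G m, expNeg (A * m + K * visits T E m x) ≤ b (word T P m x))
    (hcover : ∀ x ∈ D, x ∉ E → ∃ m, 1 ≤ m ∧ m ≤ N ∧ x ∈ G m) (n : ℕ) (x : X) (hx : x ∈ D) :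
    expNeg (A * n + K * visits T E n x + K * N) ≤ Q (word T P n x) := by
  have hsingles : ∀ (n : ℕ) (x : X), expNeg (K * n) ≤ Q (word T P n x) := by
    intro n
    induction n with
    | zero => simp [word, hQ0]
    | succ n ih =>
      intro x
      refine le_trans (le_of_eq ?_) ((mul_le_mul' (hsingle (P x)) (ih (T x))).trans
        (hQ [P x] (word T P n (T x)) (by simp)))
      rw [← expNeg_add]
      push_cast
      ring_nf
  induction n using Nat.strong_induction_on generalizing x with
  | _ n ih =>
    by_cases hn : n = 0
    · subst hn
      simp only [word, hQ0]
      rw [← expNeg_zero]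
      refine expNeg_anti ?_
      rw [visits_zero]
      simp only [Nat.cast_zero, mul_zero, zero_add]
      positivity
    by_cases hxE : x ∈ E
    · obtain ⟨n, rfl⟩ := Nat.exists_eq_succ_of_ne_zero hn
      refine le_trans ?_ ((mul_le_mul' (hsingle (P x)) (ih n (by omega) (T x) (hD hx))).trans
        (hQ [P x] (word T P n (T x)) (by simp)))
      rw [← expNeg_add, Nat.succ_eq_add_one, visits_succ, indicator_of_mem hxE]
      refine expNeg_anti ?_
      push_cast
      nlinarith
    · obtain ⟨m, hm1, hmN, hxm⟩ := hcover x hx hxE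
      by_cases hmn : m ≤ n
      · have h1 := hblock m x hxm
        have h2 := ih (n - m) (by omega) (T^[m] x) (hD.iterate m hx)
        have h3 := word_add T P m (n - m) x
        have h4 := visits_add T E m (n - m) x
        rw [show m + (n - m) = n by omega] at h3 h4
        rw [h3, h4]
        refine le_trans (le_of_eq ?_) ((mul_le_mul' h1 h2).trans (hQ _ _ ?_))
        · rw [← expNeg_add, Nat.cast_sub hmn]
          ring_nf
        · intro h
          have := length_word T P m x
          rw [h] at this
          simp at this
          omega
      · refine le_trans (expNeg_anti ?_) (hsingles n x)
        have h1 : (n : ℝ) ≤ N := by exact_mod_cast (by omega : n ≤ N)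
        have h2 := visits_nonneg T E n x
        have h3 : K * n ≤ K * N := by gcongr
        have : 0 ≤ A * n := by positivity
        have : 0 ≤ K * visits T E n x := by positivity
        linarith

end Tiling

/-- The information rate of the itinerary of length `n` of `x`. -/
noncomputable def infoRate [MeasurableSpace X] {A : Type*} (μ : Measure X) (T : X → X) (P : X → A)
    (x : X) (n : ℕ) : ℝ≥0∞ :=
  negLogNN (μ (cyl T P n x)) / n

theorem tendsto_expNeg : Tendsto expNeg atTop (𝓝 0) := by
  have : Tendsto (fun c : ℝ => ENNReal.ofReal (Real.exp (-c))) atTop (𝓝 (ENNReal.ofReal 0)) :=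
    ENNReal.tendsto_ofReal (Real.tendsto_exp_neg_atTop_nhds_zero)
  rwa [ENNReal.ofReal_zero] at this

/-- The points `y` whose orbit segment of length `m`, after integer shifts `g j` applied through
`ψ`, follows the orbit segment of `x`; the shift starts in `[-C, C]` and makes at most `c` unit
jumps. -/
def followSet [PseudoMetricSpace X] (T : X → X) (ψ : ℤ → X → X) (ε : ℝ) (m C : ℕ) (c : ℝ)
    (x : X) : Set X :=
  {y | ∃ g : ℕ → ℤ, |g 0| ≤ C ∧ (∀ j, |g (j + 1) - g j| ≤ 1) ∧
    (∑ j ∈ Finset.range m, if g (j + 1) = g j then (0 : ℝ) else 1) ≤ c ∧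
    ∀ j < m, dist (T^[j] x) (ψ (g j) (T^[j] y)) < ε}

section Follow

variable [PseudoMetricSpace X] {T : X → X} {ψ : ℤ → X → X} {ε : ℝ}

theorem isOpen_followRel (hT : Continuous T) (hψ : ∀ g, Continuous (ψ g)) (m C : ℕ) (c : ℝ) :
    IsOpen {p : X × X | p.2 ∈ followSet T ψ ε m C c p.1} := by
  have : {p : X × X | p.2 ∈ followSet T ψ ε m C c p.1} =
      ⋃ (g : ℕ → ℤ) (_ : |g 0| ≤ C) (_ : ∀ j, |g (j + 1) - g j| ≤ 1)
        (_ : (∑ j ∈ Finset.range m, if g (j + 1) = g j then (0 : ℝ) else 1) ≤ c),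
        ⋂ j ∈ Finset.range m, {p : X × X | dist (T^[j] p.1) (ψ (g j) (T^[j] p.2)) < ε} := by
    ext p
    simp only [followSet, mem_ofPred_eq, mem_iUnion, mem_iInter, Finset.mem_range, exists_prop]
  rw [this]
  refine isOpen_iUnion fun g => isOpen_iUnion fun _ => isOpen_iUnion fun _ => isOpen_iUnion fun _ =>
    isOpen_biInter_finset fun j _ => isOpen_lt ?_ continuous_const
  exact ((hT.iterate j).comp continuous_fst).dist
    ((hψ (g j)).comp ((hT.iterate j).comp continuous_snd))

theorem isOpen_followSet (hT : Continuous T) (hψ : ∀ g, Continuous (ψ g)) (m C : ℕ) (c : ℝ)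
    (x : X) : IsOpen (followSet T ψ ε m C c x) :=
  (isOpen_followRel (ε := ε) hT hψ m C c).preimage (Continuous.prodMk_right x)

theorem followSet_mono {m C C' : ℕ} {c c' : ℝ} (hC : C ≤ C') (hc : c ≤ c') (x : X) :
    followSet T ψ ε m C c x ⊆ followSet T ψ ε m C' c' x :=
  fun _ ⟨g, h1, h2, h3, h4⟩ => ⟨g, h1.trans (by exact_mod_cast hC), h2, h3.trans hc, h4⟩

theorem followSet_succ_subset (m C : ℕ) (c : ℝ) (x : X) :
    followSet T ψ ε (m + 1) C c x ⊆ T ⁻¹' followSet T ψ ε m (C + 1) c (T x) := by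
  rintro y ⟨g, h1, h2, h3, h4⟩
  refine ⟨fun j => g (j + 1), ?_, fun j => h2 (j + 1), ?_, fun j hj => ?_⟩
  · have := h2 0
    rw [abs_le] at *
    push_cast
    simp only [zero_add] at *
    omega
  · refine le_trans ?_ h3
    rw [Finset.sum_range_succ']
    have : (0 : ℝ) ≤ if g (0 + 1) = g 0 then (0 : ℝ) else 1 := by split_ifs <;> norm_num
    linarith
  · exact h4 (j + 1) (Nat.succ_lt_succ hj)

end Follow

theorem exists_block_weights [MeasurableSpace X] (μ : Measure X) [IsProbabilityMeasure μ] {k : ℕ}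
    (F : List (Fin k) → ℤ → X → ℝ≥0∞) (hF : ∀ n g y, wordSum n (fun u => F u g y) ≤ 1)
    {κ K : ℝ} (hκ : 0 < κ) (hK : k * expNeg K ≤ 1 / 2) :
    ∃ M : ℕ, 1 ≤ M ∧ ∃ b : List (Fin k) → ℝ≥0∞,
      (∀ n, ∑ m ∈ Finset.range n, wordSum (m + 1) b ≤ 1) ∧ (∀ a, expNeg K ≤ b [a]) ∧
      ∀ u : List (Fin k), M ≤ u.length → expNeg (κ * u.length) *
        ∫⁻ y, ∑ g ∈ Finset.Icc (-(u.length : ℤ)) u.length, F u g y ∂μ ≤ b u := by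
  set f : ℕ → ℝ≥0∞ := fun m => expNeg (κ * m) * (2 * m + 1 : ℕ) with hf
  have hsum : ∑' m, f m ≠ ⊤ := by
    have h1 : Summable fun m : ℕ => Real.exp (-(κ * m)) * (2 * m + 1 : ℝ) := by
      have h2 := Real.summable_pow_mul_exp_neg_nat_mul 1 hκ
      have h3 := Real.summable_pow_mul_exp_neg_nat_mul 0 hκ
      refine ((h2.mul_left 2).add h3).congr fun m => ?_
      rw [neg_mul]
      ring
    have h4 : f = fun m : ℕ => ENNReal.ofReal (Real.exp (-(κ * m)) * (2 * m + 1 : ℝ)) := by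
      funext m
      rw [ENNReal.ofReal_mul (Real.exp_pos _).le, hf]
      simp only [expNeg]
      congr 1
      rw [← ENNReal.ofReal_natCast]
      push_cast
      rfl
    rw [h4]
    exact h1.tsum_ofReal_ne_top
  obtain ⟨M, hM, hM1⟩ : ∃ M, ∑' i, f (i + M) ≤ 1 / 2 ∧ 1 ≤ M := by
    have := (ENNReal.tendsto_sum_nat_add f hsum).eventually (eventually_le_nhds
      (show (0 : ℝ≥0∞) < 1 / 2 by simp))
    exact (this.and (eventually_ge_atTop 1)).exists
  refine ⟨M, hM1, fun u => (if u.length = 1 then expNeg K else 0) +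
    if M ≤ u.length then expNeg (κ * u.length) *
        ∫⁻ y, ∑ g ∈ Finset.Icc (-(u.length : ℤ)) u.length, F u g y ∂μ else 0, ?_, ?_, ?_⟩
  · intro n
    set h : ℕ → ℝ≥0∞ := fun m => if M ≤ m then f m else 0 with hh
    have hsumh : ∑' m, h m ≤ 1 / 2 := by
      rw [← ENNReal.summable.sum_add_tsum_nat_add' (k := M)]
      have h0 : ∑ i ∈ Finset.range M, h i = 0 := Finset.sum_eq_zero fun i hi => by
        simp only [hh]
        rw [if_neg (by have := Finset.mem_range.1 hi; omega)]
      rw [h0, zero_add]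
      refine le_trans (ENNReal.tsum_le_tsum fun i => ?_) hM
      simp only [hh]
      split_ifs <;> simp
    have hterm : ∀ m ∈ Finset.range n, wordSum (m + 1) (fun u : List (Fin k) =>
        (if u.length = 1 then expNeg K else 0) +
        if M ≤ u.length then expNeg (κ * u.length) *
        ∫⁻ y, ∑ g ∈ Finset.Icc (-(u.length : ℤ)) u.length, F u g y ∂μ else 0)
        ≤ (if m = 0 then k * expNeg K else 0) + h (m + 1) := by
      intro m _
      rw [wordSum_add_fun]
      refine add_le_add ?_ ?_
      · by_cases hm : m = 0
        · subst hm
          simp [wordSum]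
        · rw [if_neg hm]
          refine le_of_eq (Finset.sum_eq_zero fun w _ => ?_)
          simp [hm]
      · simp only [hh]
        by_cases hm : M ≤ m + 1
        · have : (wordSum (m + 1) fun u : List (Fin k) =>
              if M ≤ u.length then expNeg (κ * u.length) *
              ∫⁻ y, ∑ g ∈ Finset.Icc (-(u.length : ℤ)) u.length, F u g y ∂μ else 0)
              = expNeg (κ * (m + 1 : ℕ)) * wordSum (m + 1) fun u : List (Fin k) =>
              ∫⁻ y, ∑ g ∈ Finset.Icc (-((m + 1 : ℕ) : ℤ)) (m + 1 : ℕ), F u g y ∂μ := by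
            rw [← wordSum_mul_left]
            refine wordSum_congr fun u hu => ?_
            rw [hu, if_pos hm]
          rw [this, if_pos hm, hf]
          refine mul_le_mul' le_rfl ?_
          refine (sum_lintegral_le _ _ _).trans ?_
          calc _ ≤ ∫⁻ _, ((2 * (m + 1) + 1 : ℕ) : ℝ≥0∞) ∂μ := by
                refine lintegral_mono fun y => ?_
                rw [Finset.sum_comm]
                refine (Finset.sum_le_card_nsmul _ _ 1 fun g _ => hF (m + 1) g y).trans ?_
                rw [nsmul_one, Int.card_Icc]
                norm_cast
                omega
            _ = _ := by simp
        · rw [if_neg hm]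
          refine le_of_eq (Finset.sum_eq_zero fun w _ => ?_)
          simp [hm]
    refine (Finset.sum_le_sum hterm).trans ?_
    rw [Finset.sum_add_distrib, ← ENNReal.add_halves 1]
    refine add_le_add ?_ ?_
    · rw [Finset.sum_ite_eq']
      split_ifs
      · exact hK
      · simp
    · refine le_trans ?_ hsumh
      refine (Summable.sum_le_tsum (f := fun m => h (m + 1)) _ (fun _ _ => zero_le)
        ENNReal.summable).trans ?_
      exact ENNReal.tsum_comp_le_tsum_of_injective (add_left_injective 1) h
  · intro a
    simp
  · intro u hu
    beta_reduce
    rw [if_pos hu]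
    exact le_add_self

theorem exists_coding_constant (k : ℕ) {κ : ℝ} (hκ : 0 < κ) :
    ∃ K : ℝ, κ ≤ K ∧ k * expNeg K ≤ 1 / 2 ∧ expNeg κ + (k + 2) * expNeg K ≤ 1 := by
  have hlt : expNeg κ < 1 := by
    rw [← expNeg_zero]
    exact (ENNReal.ofReal_lt_ofReal_iff (Real.exp_pos _)).2 (Real.exp_lt_exp.2 (by linarith))
  have h1 : Tendsto (fun K => (k : ℝ≥0∞) * expNeg K) atTop (𝓝 (k * 0)) :=
    ENNReal.Tendsto.const_mul tendsto_expNeg (Or.inr (ENNReal.natCast_ne_top k))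
  have h2 : Tendsto (fun K => expNeg κ + (k + 2 : ℝ≥0∞) * expNeg K) atTop
      (𝓝 (expNeg κ + (k + 2) * 0)) :=
    tendsto_const_nhds.add (ENNReal.Tendsto.const_mul tendsto_expNeg (Or.inr (by finiteness)))
  rw [mul_zero] at h1
  rw [mul_zero, add_zero] at h2
  obtain ⟨K, hK1, hK2, hK3⟩ := ((eventually_ge_atTop κ).and
    ((h1.eventually (eventually_le_nhds (show (0 : ℝ≥0∞) < 1 / 2 by simp))).and
      (h2.eventually (eventually_le_nhds hlt)))).exists
  exact ⟨K, hK1, hK2, hK3⟩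

/-- Compact approximations of the atoms of a finite partition with pairwise disjoint
thickenings. -/
theorem exists_compact_atoms [MetricSpace X] [CompactSpace X] [MeasurableSpace X] [BorelSpace X]
    (μ : Measure X) [IsProbabilityMeasure μ] {k : ℕ} {P : X → Fin k} (hP : Measurable P) {σ : ℝ}
    (hσ : 0 < σ) :
    ∃ (Z : Fin k → Set X) (ε : ℝ), 0 < ε ∧ (∀ a, Z a ⊆ P ⁻¹' {a}) ∧
      MeasurableSet (⋃ a, Z a)ᶜ ∧ μ (⋃ a, Z a)ᶜ ≤ ENNReal.ofReal σ ∧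
      ∀ a b, a ≠ b → Disjoint (Metric.thickening ε (Z a)) (Metric.thickening ε (Z b)) := by
  have hτ : ENNReal.ofReal (σ / (k + 1)) ≠ 0 := by
    rw [Ne, ENNReal.ofReal_eq_zero, not_le]; positivity
  have hPa : ∀ a, MeasurableSet (P ⁻¹' {a}) := fun a => hP (measurableSet_singleton a)
  choose Z hZsub hZc hZμ using fun a =>
    (hPa a).exists_isCompact_sdiff_lt (measure_ne_top μ _) hτ
  have hdisj : ∀ a b, ∀ᶠ ε : ℝ in 𝓝[>] 0,
      a ≠ b → Disjoint (Metric.thickening ε (Z a)) (Metric.thickening ε (Z b)) := by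
    intro a b
    by_cases hab : a = b
    · exact Eventually.of_forall fun _ h => absurd hab h
    have : Disjoint (Z a) (Z b) := Set.disjoint_left.2 fun x ha hb =>
      hab ((hZsub a ha : P x = a).symm.trans (hZsub b hb))
    obtain ⟨δ, hδ, h⟩ := this.exists_thickenings (hZc a) (hZc b).isClosed
    filter_upwards [Ioc_mem_nhdsGT hδ] with ε hε _
    exact h.mono (Metric.thickening_mono hε.2 _) (Metric.thickening_mono hε.2 _)
  have hall : ∀ᶠ ε : ℝ in 𝓝[>] 0, ∀ a b,
      a ≠ b → Disjoint (Metric.thickening ε (Z a)) (Metric.thickening ε (Z b)) :=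
    eventually_all.2 fun a => eventually_all.2 fun b => hdisj a b
  obtain ⟨ε, hε, hε0⟩ := (hall.and self_mem_nhdsWithin).exists
  refine ⟨Z, ε, hε0, hZsub, (MeasurableSet.iUnion fun a => (hZc a).measurableSet).compl, ?_, hε⟩
  have hsub : (⋃ a, Z a)ᶜ ⊆ ⋃ a, P ⁻¹' {a} \ Z a := fun x hx =>
    mem_iUnion.2 ⟨P x, rfl, fun h => hx (mem_iUnion.2 ⟨_, h⟩)⟩
  refine (measure_mono hsub).trans ((measure_iUnion_le _).trans ?_)
  rw [tsum_fintype]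
  refine (Finset.sum_le_card_nsmul _ _ _ fun a _ => (hZμ a).le).trans ?_
  rw [Finset.card_univ, Fintype.card_fin, nsmul_eq_mul, ← ENNReal.ofReal_natCast,
    ← ENNReal.ofReal_mul (Nat.cast_nonneg k)]
  refine ENNReal.ofReal_le_ofReal ?_
  rw [mul_div_assoc', div_le_iff₀ (by positivity)]
  nlinarith

/-- Points whose follow sets are frequently large. -/
def richSet [PseudoMetricSpace X] [MeasurableSpace X] (μ : Measure X) (T : X → X) (ψ : ℤ → X → X)
    (ε δ a : ℝ) : Set X :=
  {x | ∃ C : ℕ, ∃ᶠ m : ℕ in atTop,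
    expNeg (C + a * m) ≤ μ (followSet T ψ ε m C (δ * m + C) x)}

theorem mapsTo_richSet [PseudoMetricSpace X] [MeasurableSpace X] [BorelSpace X] {μ : Measure X}
    {T : X → X} (hTc : Continuous T) (hT : MeasurePreserving T μ μ) {ψ : ℤ → X → X}
    (hψ : ∀ g, Continuous (ψ g)) {ε δ a : ℝ} (hδ : δ ≤ 1) :
    MapsTo T (richSet μ T ψ ε δ a) (richSet μ T ψ ε δ a) := by
  rintro x ⟨C, hC⟩
  refine ⟨C + 1 + ⌈a⌉₊, fun hcon => hC ?_⟩
  obtain ⟨m₀, hm₀⟩ := eventually_atTop.1 hcon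
  refine eventually_atTop.2 ⟨m₀ + 1, fun m hm hle => ?_⟩
  obtain ⟨m, rfl⟩ := Nat.exists_eq_add_of_le' (show 1 ≤ m by omega)
  refine hm₀ m (by omega) ?_
  have hceil := Nat.le_ceil a
  have hceil0 : (0 : ℝ) ≤ ⌈a⌉₊ := Nat.cast_nonneg _
  calc _ ≤ expNeg (C + a * (m + 1 : ℕ)) := by
        refine expNeg_anti ?_
        push_cast
        linarith
    _ ≤ _ := hle
    _ ≤ μ (T ⁻¹' followSet T ψ ε m (C + 1) (δ * (m + 1 : ℕ) + C) (T x)) :=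
        measure_mono (followSet_succ_subset _ _ _ _)
    _ = μ (followSet T ψ ε m (C + 1) (δ * (m + 1 : ℕ) + C) (T x)) :=
        hT.measure_preimage (isOpen_followSet hTc hψ _ _ _ _).measurableSet.nullMeasurableSet
    _ ≤ _ := by
        refine measure_mono (followSet_mono (by omega) ?_ _)
        push_cast
        linarith

theorem exists_measure_diff_iUnion_lt [MeasurableSpace X] (μ : Measure X) [IsProbabilityMeasure μ]
    {G : ℕ → Set X} (hG : ∀ m, MeasurableSet (G m)) {σ : ℝ} (hσ : 0 < σ) :
    ∃ N, μ ((⋃ m, G m) \ ⋃ m ≤ N, G m) < ENNReal.ofReal σ := by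
  have hmeas : ∀ N : ℕ, MeasurableSet ((⋃ m, G m) \ ⋃ m ≤ N, G m) := fun N =>
    (MeasurableSet.iUnion hG).diff
      (MeasurableSet.iUnion fun m => MeasurableSet.iUnion fun _ => hG m)
  have hanti : Antitone fun N : ℕ => (⋃ m, G m) \ ⋃ m ≤ N, G m := fun N N' h =>
    sdiff_subset_sdiff_right (biUnion_subset_biUnion_left fun m hm => le_trans hm h)
  have := tendsto_measure_iInter_atTop (μ := μ) (fun N => (hmeas N).nullMeasurableSet) hanti
    ⟨0, measure_ne_top μ _⟩
  have hempty : ⋂ N : ℕ, ((⋃ m, G m) \ ⋃ m ≤ N, G m) = ∅ := by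
    refine eq_empty_of_forall_notMem fun x hx => ?_
    obtain ⟨m, hm⟩ := mem_iUnion.1 (mem_iInter.1 hx 0).1
    exact (mem_iInter.1 hx m).2 (mem_iUnion₂.2 ⟨m, le_rfl, hm⟩)
  rw [hempty, measure_empty] at this
  exact (this.eventually (gt_mem_nhds (ENNReal.ofReal_pos.2 hσ))).exists

/-- On the set where follow sets are frequently not exponentially small at rate `a`, the
information rate is asymptotically at most `a`, up to small errors. -/
theorem exists_measure_richSet_le [MetricSpace X] [CompactSpace X] [MeasurableSpace X]
    [BorelSpace X] {μ : Measure X} [IsProbabilityMeasure μ] {T : X → X} (hTc : Continuous T)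
    (hT : MeasurePreserving T μ μ) {k : ℕ} {P : X → Fin k} (hP : Measurable P) {a κ : ℝ}
    (ha : 0 ≤ a) (hκ : 0 < κ) :
    ∃ δ : ℝ, 0 < δ ∧ ∀ ρ : ℝ, 0 < ρ → ∃ ε : ℝ, 0 < ε ∧ ∀ ψ : ℤ → X → X, (∀ g, Continuous (ψ g)) →
      μ {x | x ∈ richSet μ T ψ ε δ a ∧
        ENNReal.ofReal (a + 9 * κ) < limsup (infoRate μ T P x) atTop} ≤ ENNReal.ofReal ρ := by
  obtain ⟨K, hκK, hK1, hK2⟩ := exists_coding_constant k hκ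
  have hK0 : 0 < K := hκ.trans_le hκK
  set δ := κ / K with hδ
  have hδ0 : 0 < δ := div_pos hκ hK0
  have hδ1 : δ ≤ 1 := (div_le_one hK0).2 hκK
  have hKδ : K * δ = κ := by rw [hδ]; field_simp
  refine ⟨δ, hδ0, fun ρ hρ => ?_⟩
  have hσ : 0 < ρ * δ / 2 := by positivity
  obtain ⟨Z, ε, hε, hZsub, hZm, hZμ, hZd⟩ := exists_compact_atoms μ hP hσ
  refine ⟨ε, hε, fun ψ hψ => ?_⟩
  classical
  set e : ℤ → X → Fin k → ℝ≥0∞ := fun g z i =>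
    if ψ g z ∈ Metric.thickening ε (Z i) then expNeg κ else expNeg K with he
  have he1 : ∀ g z, ∑ i, e g z i ≤ 1 := by
    intro g z
    refine le_trans ?_ hK2
    by_cases h : ∃ i, ψ g z ∈ Metric.thickening ε (Z i)
    · obtain ⟨i, hi⟩ := h
      have hle : ∀ j, e g z j ≤ (if j = i then expNeg κ else 0) + expNeg K := by
        intro j
        by_cases hj : j = i
        · simp only [he]
          rw [if_pos hj]
          split_ifs
          · exact le_self_add
          · exact le_add_self
        · simp only [he]
          rw [if_neg hj, zero_add, if_neg fun hz =>
            Set.disjoint_left.1 (hZd j i hj) hz hi]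
      refine (Finset.sum_le_sum fun j _ => hle j).trans ?_
      rw [Finset.sum_add_distrib, Finset.sum_ite_eq', if_pos (Finset.mem_univ i)]
      simp only [Finset.sum_const, Finset.card_univ, Fintype.card_fin, nsmul_eq_mul]
      gcongr
      exact le_self_add
    · push Not at h
      simp only [he, h, if_false, Finset.sum_const, Finset.card_univ, Fintype.card_fin,
        nsmul_eq_mul]
      refine le_trans ?_ le_add_self
      gcongr
      exact le_self_add
  have hpq : expNeg κ + expNeg K + expNeg K ≤ 1 := by
    refine le_trans ?_ hK2
    rw [add_assoc, ← two_mul]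
    gcongr
    exact le_add_self
  obtain ⟨M, hM1, b, hb, hb1, hbM⟩ := exists_block_weights μ
    (hiddenWeight T e (expNeg κ) (expNeg K))
    (fun n g y => wordSum_hiddenWeight_le T e _ _ he1 hpq n g y) hκ hK1
  obtain ⟨Q, hQ, hQ0, hQmul⟩ := exists_tiling_weight b hb
  set G : ℕ → Set X := fun m => {x | M ≤ m ∧
    expNeg ((a + κ) * m) ≤ μ (followSet T ψ ε m m (2 * δ * m) x)} with hG
  have hGm : ∀ m, MeasurableSet (G m) := fun m => by
    have hm : MeasurableSet {x | expNeg ((a + κ) * m) ≤ μ (followSet T ψ ε m m (2 * δ * m) x)} :=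
      measurableSet_le measurable_const (measurable_measure_prodMk_left
        (isOpen_followRel (ε := ε) hTc hψ m m (2 * δ * m)).measurableSet)
    exact (MeasurableSet.const (M ≤ m)).inter hm
  obtain ⟨N, hN⟩ := exists_measure_diff_iUnion_lt μ hGm hσ
  set E₀ : Set X := (⋃ i, Z i)ᶜ
  set E : Set X := E₀ ∪ ((⋃ m, G m) \ ⋃ m ≤ N, G m) with hE
  have hEm : MeasurableSet E := hZm.union ((MeasurableSet.iUnion hGm).diff
    (MeasurableSet.iUnion fun m => MeasurableSet.iUnion fun _ => hGm m))
  have hEμ : μ.real E ≤ ρ * δ := by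
    refine ENNReal.toReal_le_of_le_ofReal (by positivity) ((measure_union_le _ _).trans ?_)
    refine (add_le_add hZμ hN.le).trans ?_
    rw [← ENNReal.ofReal_add hσ.le hσ.le, add_halves]
  set D := richSet μ T ψ ε δ a with hD
  have hblock : ∀ m, ∀ x ∈ G m,
      expNeg ((a + 6 * κ) * m + K * visits T E m x) ≤ b (word T P m x) := by
    rintro m x ⟨hMm, hx⟩
    refine le_trans ?_ (hbM (word T P m x) (by rwa [length_word]))
    rw [length_word]
    have hint : expNeg (4 * κ * m + K * visits T E m x) * expNeg ((a + κ) * m) ≤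
        ∫⁻ y, ∑ g ∈ Finset.Icc (-(m : ℤ)) m,
          hiddenWeight T e (expNeg κ) (expNeg K) (word T P m x) g y ∂μ := by
      refine (mul_le_mul' le_rfl hx).trans ?_
      rw [← lintegral_indicator_const (isOpen_followSet hTc hψ _ _ _ _).measurableSet]
      refine lintegral_mono fun y => ?_
      by_cases hy : y ∈ followSet T ψ ε m m (2 * δ * m) x
      swap
      · rw [indicator_of_notMem hy]
        exact zero_le
      rw [indicator_of_mem hy]
      obtain ⟨g, h1, h2, h3, h4⟩ := hy
      refine le_trans ?_ (Finset.single_le_sum (f := fun g =>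
        hiddenWeight T e (expNeg κ) (expNeg K) (word T P m x) g y) (fun _ _ => zero_le)
        (Finset.mem_Icc.2 (abs_le.1 h1)))
      refine le_trans ?_ (expNeg_le_hiddenWeight (E := E) m g x y h2 (fun j hj => ?_) hκ.le)
      · refine expNeg_anti ?_
        have := mul_le_mul_of_nonneg_left h3 hK0.le
        have h5 : K * (2 * δ * m) = 2 * κ * m := by rw [← hKδ]; ring
        linarith
      · by_cases hjE : T^[j] x ∈ E
        · rw [indicator_of_mem hjE, mul_one]
          simp only [he]
          split_ifs
          · exact expNeg_anti (by linarith)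
          · exact expNeg_anti (by linarith)
        · rw [indicator_of_notMem hjE, mul_zero, add_zero]
          have hz : T^[j] x ∈ ⋃ i, Z i := by
            by_contra h
            exact hjE (Or.inl h)
          obtain ⟨i, hi⟩ := mem_iUnion.1 hz
          have hPi : P (T^[j] x) = i := hZsub i hi
          simp only [he]
          rw [if_pos]
          rw [Metric.mem_thickening_iff]
          exact ⟨T^[j] x, hPi ▸ hi, by rw [dist_comm]; exact h4 j hj⟩
    refine le_trans (le_of_eq ?_) (mul_le_mul' le_rfl hint)
    rw [← expNeg_add, ← expNeg_add]
    ring_nf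
  have hDG : D ⊆ ⋃ m, G m := by
    rintro x ⟨C, hC⟩
    obtain ⟨m, hm, hmM, hmC, hmκ, hmδ⟩ := (hC.and_eventually ((eventually_ge_atTop M).and
      ((eventually_ge_atTop C).and
      ((tendsto_natCast_atTop_atTop.eventually (eventually_ge_atTop ((C : ℝ) / κ))).and
      (tendsto_natCast_atTop_atTop.eventually (eventually_ge_atTop ((C : ℝ) / δ))))))).exists
    rw [div_le_iff₀ hκ] at hmκ
    rw [div_le_iff₀ hδ0] at hmδ
    refine mem_iUnion.2 ⟨m, hmM, ?_⟩
    refine (expNeg_anti ?_).trans (hm.trans (measure_mono (followSet_mono hmC ?_ _)))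
    · linarith
    · linarith
  have hcover : ∀ x ∈ D, x ∉ E → ∃ m, 1 ≤ m ∧ m ≤ N ∧ x ∈ G m := by
    intro x hx hxE
    have : x ∈ ⋃ m ≤ N, G m := by
      by_contra h
      exact hxE (Or.inr ⟨hDG hx, h⟩)
    obtain ⟨m, hm, hxm⟩ := mem_iUnion₂.1 this
    exact ⟨m, hM1.trans hxm.1, hm, hxm⟩
  have htile := expNeg_le_tiling hQ0 hQmul (by positivity : 0 ≤ a + 6 * κ) hK0.le
    (mapsTo_richSet hTc hT hψ hδ1) hb1 hblock hcover
  have hae : ∀ᵐ x ∂μ, x ∉ {x | x ∈ D ∧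
      ENNReal.ofReal (a + 9 * κ) < limsup (infoRate μ T P x) atTop} \
      {x | ∃ n : ℕ, 1 ≤ n ∧ δ * n < visits T E n x} := by
    filter_upwards [ae_eventually_weight_le (T := T) (P := P) μ Q hQ hκ] with x hx
    rintro ⟨⟨hxD, hlt⟩, hnot⟩
    refine absurd hlt (not_lt.2 ?_)
    refine limsup_le_of_le (by isBoundedDefault) ?_
    filter_upwards [hx, eventually_ge_atTop 1, tendsto_natCast_atTop_atTop.eventually
      (eventually_ge_atTop (K * N / κ))] with n hn hn1 hnN
    have hv : visits T E n x ≤ δ * n := by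
      by_contra h
      exact hnot ⟨n, hn1, not_le.1 h⟩
    rw [div_le_iff₀ hκ] at hnN
    have hn0 : (0 : ℝ) < n := by exact_mod_cast hn1
    have h1 : expNeg ((a + 9 * κ) * n) ≤ μ (cyl T P n x) := by
      refine le_trans ?_ ((mul_le_mul' le_rfl (htile n x hxD)).trans hn)
      rw [← expNeg_add]
      refine expNeg_anti ?_
      have := mul_le_mul_of_nonneg_left hv hK0.le
      rw [← mul_assoc, hKδ] at this
      linarith
    have h2 := negLogNN_anti h1 (measure_ne_top μ _)
    rw [negLogNN_expNeg] at h2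
    unfold infoRate
    refine ENNReal.div_le_of_le_mul (h2.trans (le_of_eq ?_))
    rw [ENNReal.ofReal_mul (by positivity), ENNReal.ofReal_natCast]
  refine (measure_mono_ae ?_).trans ((maximal_visits hT hEm hδ0).trans
    (ENNReal.ofReal_le_ofReal ((div_le_iff₀ hδ0).2 hEμ)))
  filter_upwards [hae] with x hx hx1
  by_contra h
  exact hx ⟨hx1, h⟩

section Topological

variable [TopologicalSpace X] {φ : ℝ → X → X}

theorem IsFlow.continuous (hφ : IsFlow φ) (t : ℝ) : Continuous (φ t) :=
  hφ.cont.comp (Continuous.prodMk_right t)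

theorem IsFlow.iterate_one (hφ : IsFlow φ) (j : ℕ) (x : X) : (φ 1)^[j] x = φ j x := by
  induction j with
  | zero => simp [hφ.map_zero]
  | succ j ih =>
    rw [Function.iterate_succ_apply', ih, ← hφ.map_add]
    push_cast
    rw [add_comm]

theorem IsFlow.map_int_mul (hφ : IsFlow φ) {u : ℝ} {z : X} (h : φ u z = z) (k : ℤ) :
    φ (k * u) z = z := by
  have hneg : φ (-u) z = z := by
    conv_lhs => rw [← h]
    rw [← hφ.map_add, neg_add_cancel, hφ.map_zero]
  induction k using Int.induction_on with
  | zero => simp [hφ.map_zero]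
  | succ k ih =>
    push_cast at *
    rw [add_mul, one_mul, hφ.map_add, h, ih]
  | pred k ih =>
    push_cast at *
    rw [sub_mul, one_mul, sub_eq_add_neg, hφ.map_add, hneg, ih]

end Topological

section Flow

variable [MetricSpace X] [CompactSpace X] {φ : ℝ → X → X}

/-- A fixed-point free flow on a compact space has no arbitrarily small periods. -/
theorem IsFlow.exists_no_small_period (hφ : IsFlow φ) (hfp : FixedPointFree φ) :
    ∃ T₀ : ℝ, 0 < T₀ ∧ ∀ u, 0 < u → u ≤ T₀ → ∀ z, φ u z ≠ z := by
  by_contra! hcon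
  choose u hu0 hu z hz using fun n : ℕ => hcon (1 / (n + 1)) Nat.one_div_pos_of_nat
  obtain ⟨w, -, θ, hθ, hw⟩ := isCompact_univ.tendsto_subseq (x := z) fun n => mem_univ _
  obtain ⟨t, ht⟩ := hfp w
  have hu_lim : Tendsto (fun n => u (θ n)) atTop (𝓝 0) :=
    (squeeze_zero (fun n => (hu0 n).le) hu tendsto_one_div_add_atTop_nhds_zero_nat).comp
      hθ.tendsto_atTop
  have hr : Tendsto (fun n => t - ⌊t / u (θ n)⌋ * u (θ n)) atTop (𝓝 0) := by
    refine squeeze_zero (fun n => ?_) (fun n => ?_) hu_lim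
    · have := (le_div_iff₀ (hu0 (θ n))).1 (Int.floor_le (t / u (θ n)))
      linarith
    · have := (div_lt_iff₀ (hu0 (θ n))).1 (Int.lt_floor_add_one (t / u (θ n)))
      linarith
  have h1 : Tendsto (fun n => φ (t - ⌊t / u (θ n)⌋ * u (θ n)) (z (θ n))) atTop (𝓝 (φ 0 w)) :=
    (hφ.cont.tendsto (0, w)).comp (hr.prodMk_nhds hw)
  have h2 : Tendsto (fun n => φ t (z (θ n))) atTop (𝓝 (φ t w)) :=
    ((hφ.continuous t).tendsto w).comp hw
  refine ht ((tendsto_nhds_unique h2 (h1.congr fun n => ?_)).trans (hφ.map_zero w))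
  conv_rhs => rw [← sub_add_cancel t (⌊t / u (θ n)⌋ * u (θ n)), hφ.map_add,
    hφ.map_int_mul (hz (θ n))]

theorem IsFlow.exists_uniform (hφ : IsFlow φ) (L : ℝ) {c : ℝ} (hc : 0 < c) :
    ∃ ε : ℝ, 0 < ε ∧ ∀ u ∈ Icc 0 L, ∀ v ∈ Icc 0 L, ∀ x y, |u - v| < ε → dist x y < ε →
      dist (φ u x) (φ v y) < c := by
  have := (isCompact_Icc.prod isCompact_univ : IsCompact (Icc (0 : ℝ) L ×ˢ (univ : Set X))
    ).uniformContinuousOn_of_continuous hφ.cont.continuousOn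
  obtain ⟨ε, hε, h⟩ := Metric.uniformContinuousOn_iff.1 this c hc
  refine ⟨ε, hε, fun u hu v hv x y huv hxy => ?_⟩
  refine h (u, x) ⟨hu, mem_univ _⟩ (v, y) ⟨hv, mem_univ _⟩ ?_
  rw [Prod.dist_eq]
  exact max_lt (by rwa [Real.dist_eq]) hxy

theorem IsFlow.exists_small_shift (hφ : IsFlow φ) {c : ℝ} (hc : 0 < c) :
    ∃ η : ℝ, 0 < η ∧ ∀ r, |r| ≤ η → ∀ z, dist (φ r z) z < c := by
  obtain ⟨ε, hε, h⟩ := hφ.exists_uniform 1 hc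
  have key : ∀ r, 0 ≤ r → r ≤ min (ε / 2) 1 → ∀ z, dist (φ r z) z < c := by
    intro r hr hr' z
    have := h r ⟨hr, hr'.trans (min_le_right _ _)⟩ 0 ⟨le_rfl, zero_le_one⟩ z z
      (by rw [sub_zero, abs_of_nonneg hr]; linarith [min_le_left (ε / 2) 1]) (by simpa using hε)
    rwa [hφ.map_zero] at this
  refine ⟨min (ε / 2) 1, by positivity, fun r hr z => ?_⟩
  rw [abs_le] at hr
  rcases le_total 0 r with h0 | h0
  · exact key r h0 hr.2 z
  · have := key (-r) (by linarith) (by linarith) (φ r z)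
    rwa [← hφ.map_add, neg_add_cancel, hφ.map_zero, dist_comm] at this

theorem IsFlow.exists_shift_ge (hφ : IsFlow φ) {η : ℝ} (h : ∀ z, φ η z ≠ z) :
    ∃ c : ℝ, 0 < c ∧ ∀ r, |r| = η → ∀ z, c ≤ dist (φ r z) z := by
  have hcont : Continuous fun z => dist (φ η z) z := (hφ.continuous η).dist continuous_id
  obtain ⟨c, hc, hle⟩ := isCompact_univ.exists_forall_le' (a := 0) hcont.continuousOn
    fun z _ => dist_pos.2 (h z)
  refine ⟨c, hc, fun r hr z => ?_⟩
  rcases abs_choice r with h' | h'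
  · rw [← h', hr]
    exact hle z (mem_univ _)
  · have := hle (φ r z) (mem_univ _)
    rwa [← hφ.map_add, ← hr, h', neg_add_cancel, hφ.map_zero, dist_comm] at this

/-- A reparametrization along which two orbits stay close is close to a translation on bounded
time windows. -/
theorem IsFlow.exists_reparam_rigidity (hφ : IsFlow φ) (hfp : FixedPointFree φ) {η₀ : ℝ}
    (hη₀ : 0 < η₀) (L : ℝ) :
    ∃ ε : ℝ, 0 < ε ∧ ∀ (α : ℝ → ℝ) (t : ℝ) (x y : X), ContinuousOn α (Icc 0 t) →
      (∀ s ∈ Icc 0 t, dist (φ (α s) x) (φ s y) < ε) →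
      ∀ s u, 0 ≤ s → 0 ≤ u → u ≤ L → s + u ≤ t → |α (s + u) - α s - u| < η₀ := by
  obtain ⟨T₀, hT₀, hper⟩ := hφ.exists_no_small_period hfp
  set η := min η₀ T₀ with hη
  have hη0 : 0 < η := lt_min hη₀ hT₀
  obtain ⟨c, hc, hcle⟩ := hφ.exists_shift_ge (hper η hη0 (min_le_right _ _))
  obtain ⟨ε, hε, hunif⟩ := hφ.exists_uniform L (half_pos hc)
  refine ⟨min ε (c / 2), by positivity, fun α t x y hα hclose s u hs hu huL hsu => ?_⟩
  by_contra! hge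
  have hcont : ContinuousOn (fun v => |α (s + v) - α s - v|) (Icc 0 u) := by
    have h1 : ContinuousOn (fun v => α (s + v)) (Icc 0 u) :=
      hα.comp (continuous_const.add continuous_id).continuousOn fun v hv =>
        ⟨by simpa using add_nonneg hs hv.1, by simpa using (add_le_add_right hv.2 s).trans hsu⟩
    exact ((h1.sub continuousOn_const).sub continuousOn_id).abs
  obtain ⟨v, hv, hveq⟩ := intermediate_value_Icc hu hcont
    (show η ∈ Icc _ _ from ⟨by simpa using hη0.le, (min_le_left _ _).trans hge⟩)
  have h1 := hclose (s + v) ⟨by linarith [hv.1], by linarith [hv.2]⟩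
  have h2 := hunif v ⟨hv.1, hv.2.trans huL⟩ v ⟨hv.1, hv.2.trans huL⟩ _ _ (by simpa using hε)
    ((hclose s ⟨hs, by linarith⟩).trans_le (min_le_left _ _))
  rw [← hφ.map_add, ← hφ.map_add] at h2
  have h3 := hcle _ hveq (φ (v + α s) x)
  rw [← hφ.map_add, show α (s + v) - α s - v + (v + α s) = α (s + v) by ring] at h3
  have h4 := dist_triangle_right (φ (α (s + v)) x) (φ (v + α s) x) (φ (s + v) y)
  rw [add_comm v s] at h2
  have h5 := min_le_right ε (c / 2)
  linarith

theorem IsFlow.exists_reparBall_subset_followSet (hφ : IsFlow φ) (hfp : FixedPointFree φ)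
    {ε' δ : ℝ} (hε' : 0 < ε') {L : ℕ} (hL : 1 ≤ L * δ) :
    ∃ η : ℝ, ∃ ε : ℝ, 0 < ε ∧ ∀ (x : X) (t : ℝ), reparBall φ x t ε ⊆
      followSet (φ 1) (fun g => φ (η * g)) ε' (⌊t / (L + 1)⌋₊ * L) 0
        (δ * (⌊t / (L + 1)⌋₊ * L : ℕ)) x := by
  have hL0 : 0 < L := by
    rcases Nat.eq_zero_or_pos L with h | h
    · rw [h, Nat.cast_zero, zero_mul] at hL
      linarith
    · exact h
  obtain ⟨η₁, hη₁, hshift⟩ := hφ.exists_small_shift (half_pos hε')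
  set η := min (η₁ / 2) 1 with hη
  have hη0 : 0 < η := by positivity
  have hηη : 2 * η ≤ η₁ := by linarith [min_le_left (η₁ / 2) 1]
  have hη1 : η ≤ 1 := min_le_right _ _
  obtain ⟨ε₁, hε₁, hrigid⟩ := hφ.exists_reparam_rigidity hfp hη0 (L + 1)
  refine ⟨η, min ε₁ (ε' / 2), by positivity, ?_⟩
  rintro x t y ⟨α, ⟨hα, -, hα0⟩, hclose⟩
  set k := ⌊t / (L + 1)⌋₊ with hk
  have hstep : ∀ s, 0 ≤ s → s + (L + 1) ≤ t → ∀ i ≤ L,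
      ∃ u ∈ Icc (0 : ℝ) (L + 1), α (s + u) = α s + i ∧ |u - i| < η := by
    intro s hs hst i hi
    have hi' : (i : ℝ) ≤ L := by exact_mod_cast hi
    have hr := hrigid α t x y hα fun s hs => (hclose s hs).trans_le (min_le_left _ _)
    have hcont : ContinuousOn (fun u => α (s + u)) (Icc 0 (L + 1 : ℝ)) :=
      hα.comp (continuous_const.add continuous_id).continuousOn fun v hv =>
        ⟨by simpa using add_nonneg hs hv.1, by simpa using (add_le_add_right hv.2 s).trans hst⟩
    have hend := abs_lt.1 (hr s (L + 1) hs (by positivity) le_rfl hst)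
    obtain ⟨u, hu, hueq⟩ := intermediate_value_Icc (by positivity) hcont
      (show α s + i ∈ Icc _ _ from ⟨by simp, by linarith [hend.1]⟩)
    refine ⟨u, hu, hueq, ?_⟩
    have := hr s u hs hu.1 hu.2 (by linarith [hu.2])
    simp only at hueq
    rwa [hueq, add_sub_cancel_left, abs_sub_comm] at this
  choose! U hU hUα hUη using fun s hs hst => hstep s hs hst L le_rfl
  set S : ℕ → ℝ := fun b => Nat.rec 0 (fun _ s => s + U s) b with hS
  have hSsucc : ∀ b, S (b + 1) = S b + U (S b) := fun b => rfl
  have hbt : ∀ b : ℕ, b < k → (b + 1 : ℝ) * (L + 1) ≤ t := by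
    intro b hb
    have := (Nat.le_floor_iff' b.succ_ne_zero).1 (Nat.succ_le_of_lt hb)
    rw [le_div_iff₀ (by positivity)] at this
    exact_mod_cast this
  have hSb : ∀ b : ℕ, b ≤ k → 0 ≤ S b ∧ S b ≤ b * (L + 1) ∧ α (S b) = b * L := by
    intro b
    induction b with
    | zero => intro _; simp [hS, hα0]
    | succ b ih =>
      intro hb
      obtain ⟨h1, h2, h3⟩ := ih (by omega)
      have h4 := hbt b hb
      push_cast
      have h5 : S b + (L + 1) ≤ t := by linarith
      have h6 := hU _ h1 h5
      rw [hSsucc, hUα _ h1 h5, h3]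
      exact ⟨by linarith [h6.1], by linarith [h6.2], by ring⟩
  set d : ℕ → ℝ := fun b => (S b - b * L) / η with hd
  have hdsucc : ∀ b, b < k → |d (b + 1) - d b| < 1 := by
    intro b hb
    obtain ⟨h1, h2, h3⟩ := hSb b hb.le
    have h4 := hbt b hb
    have h5 := hUη _ h1 (by linarith)
    have h6 : d (b + 1) - d b = (U (S b) - L) / η := by
      simp only [hd, hSsucc]
      push_cast
      ring
    rwa [h6, abs_div, abs_of_pos hη0, div_lt_one hη0]
  set B : ℕ → ℕ := fun j => min (j / L) k with hB
  have hBsucc : ∀ j, B (j + 1) = B j ∨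
      (B (j + 1) = B j + 1 ∧ B j < k ∧ (j + 1) / L = j / L + 1) := by
    intro j
    have := Nat.succ_div (a := j) (b := L)
    simp only [hB]
    split_ifs at this <;> rw [this] <;> omega
  refine ⟨fun j => ⌊d (B j)⌋, ?_, ?_, ?_, ?_⟩
  · simp [hB, hd, hS]
  · intro j
    rcases hBsucc j with h | ⟨h, hlt, -⟩
    · simp [h]
    · have := abs_lt.1 (hdsucc _ hlt)
      simp only [h]
      have h1 := Int.floor_le (d (B j + 1))
      have h2 := Int.lt_floor_add_one (d (B j + 1))
      have h3 := Int.floor_le (d (B j))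
      have h4 := Int.lt_floor_add_one (d (B j))
      rw [abs_le]
      constructor
      · have : (-2 : ℝ) < (⌊d (B j + 1)⌋ - ⌊d (B j)⌋ : ℤ) := by push_cast; linarith
        have : (-2 : ℤ) < (⌊d (B j + 1)⌋ - ⌊d (B j)⌋ : ℤ) := by exact_mod_cast this
        omega
      · have : (⌊d (B j + 1)⌋ - ⌊d (B j)⌋ : ℤ) < (2 : ℝ) := by push_cast; linarith
        have : (⌊d (B j + 1)⌋ - ⌊d (B j)⌋ : ℤ) < (2 : ℤ) := by exact_mod_cast this
        omega
  · have hcount : ∀ n, (∑ j ∈ Finset.range n, if ⌊d (B (j + 1))⌋ = ⌊d (B j)⌋ then (0 : ℝ) else 1) ≤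
        (n / L : ℕ) := by
      intro n
      induction n with
      | zero => simp
      | succ n ih =>
        rw [Finset.sum_range_succ]
        rcases hBsucc n with h | ⟨-, -, h⟩
        · rw [h, if_pos rfl, add_zero]
          exact ih.trans (by exact_mod_cast Nat.div_le_div_right (Nat.le_succ n))
        · rw [h]
          push_cast
          exact add_le_add ih (by split_ifs <;> norm_num)
    refine (hcount _).trans ?_
    rw [Nat.mul_div_cancel _ hL0]
    push_cast
    nlinarith [Nat.cast_nonneg (α := ℝ) k]
  · intro j hj
    have hBj : B j = j / L := min_eq_left ((Nat.div_lt_of_lt_mul (by rwa [mul_comm])).le)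
    have hlt : j / L < k := Nat.div_lt_of_lt_mul (by rwa [mul_comm])
    simp only [hBj]
    set b := j / L with hb
    obtain ⟨h1, h2, h3⟩ := hSb b hlt.le
    have h4 := hbt b hlt
    obtain ⟨u, hu, hueq, huη⟩ := hstep (S b) h1 (by linarith) (j % L) (Nat.mod_lt j hL0).le
    have hj' : (b : ℝ) * L + (j % L : ℕ) = j := by
      exact_mod_cast Nat.div_add_mod' j L
    rw [h3, hj'] at hueq
    have h5 := hclose (S b + u) ⟨by linarith [hu.1], by linarith [hu.2]⟩
    rw [hueq] at h5
    rw [hφ.iterate_one, hφ.iterate_one, ← hφ.map_add]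
    have h6 := hshift (η * ⌊d b⌋ + j - (S b + u)) ?_ (φ (S b + u) y)
    · rw [← hφ.map_add, sub_add_cancel] at h6
      have h7 := dist_triangle_right (φ j x) (φ (η * ⌊d b⌋ + j) y) (φ (S b + u) y)
      have h8 := min_le_right ε₁ (ε' / 2)
      linarith
    · have h7 : S b - b * L = η * d b := by
        simp only [hd]
        field_simp
      have h8 := mul_le_mul_of_nonneg_left (Int.floor_le (d b)) hη0.le
      have h9 := mul_le_mul_of_nonneg_left (Int.lt_floor_add_one (d b)).le hη0.le
      rw [abs_lt] at huη
      rw [abs_le]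
      constructor <;> linarith [huη.1, huη.2]

end Flow

section LowerEstimate

variable [MetricSpace X] [CompactSpace X] [MeasurableSpace X] {φ : ℝ → X → X}

theorem IsFlow.exists_shifts_mem_richSet (hφ : IsFlow φ) (hfp : FixedPointFree φ) (μ : Measure X)
    [IsProbabilityMeasure μ] {a κ δ ε' : ℝ} (ha : 0 ≤ a) (hκ : 0 < κ) (hδ : 0 < δ)
    (hε' : 0 < ε') :
    ∃ ψ : ℤ → X → X, (∀ g, Continuous (ψ g)) ∧ ∀ x, lowerLocalEnt μ φ x < ENNReal.ofReal a →
      x ∈ richSet μ (φ 1) ψ ε' δ (a + κ) := by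
  obtain ⟨L, hL⟩ := exists_nat_ge (max (1 / δ) (max 1 (a / κ)))
  have hL1 : 1 ≤ L * δ := by
    rw [← div_le_iff₀ hδ]
    exact (le_max_left _ _).trans hL
  have hL2 : (1 : ℝ) ≤ L := ((le_max_left _ _).trans (le_max_right _ _)).trans hL
  have hL3 : a ≤ L * κ := by
    rw [← div_le_iff₀ hκ]
    exact ((le_max_right _ _).trans (le_max_right _ _)).trans hL
  obtain ⟨η, ε, hε, hsub⟩ := hφ.exists_reparBall_subset_followSet hfp hε' hL1
  refine ⟨fun g => φ (η * g), fun g => hφ.continuous _, fun x hx => ⟨⌈a * (L + 1)⌉₊, ?_⟩⟩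
  have hlt : liminf (fun t : ℝ => localRate μ φ x ε t) atTop < ENNReal.ofReal a :=
    (le_iSup₂ (f := fun (ε : ℝ) (_ : 0 < ε) =>
      liminf (fun t : ℝ => localRate μ φ x ε t) atTop) ε hε).trans_lt hx
  have hfreq := frequently_lt_of_liminf_lt (by isBoundedDefault) hlt
  have htend : Tendsto (fun t : ℝ => ⌊t / (L + 1)⌋₊ * L) atTop atTop :=
    (tendsto_nat_floor_atTop.comp (tendsto_id.atTop_div_const (by positivity))).atTop_mul_const'
      (by exact_mod_cast hL2)
  refine htend.frequently ((hfreq.and_eventually (eventually_gt_atTop 0)).mono ?_)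
  rintro t ⟨hrate, ht⟩
  have h1 : negLogNN (μ (reparBall φ x t ε)) ≤ ENNReal.ofReal (a * t) := by
    rw [ENNReal.ofReal_mul ha]
    exact (ENNReal.div_le_iff_le_mul (Or.inl (ENNReal.ofReal_pos.2 ht).ne')
      (Or.inl ENNReal.ofReal_ne_top)).1 hrate.le
  refine (expNeg_anti ?_).trans ((expNeg_le_of_negLogNN_le (measure_ne_top μ _) (by positivity)
    h1).trans (measure_mono ((hsub x t).trans (followSet_mono (Nat.zero_le _) ?_ x))))
  · have h2 := Nat.lt_floor_add_one (t / (L + 1))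
    rw [div_lt_iff₀ (by positivity)] at h2
    have h3 := Nat.le_ceil (a * (L + 1))
    have h4 := mul_le_mul_of_nonneg_left h2.le ha
    have h5 := mul_le_mul_of_nonneg_left hL3 (Nat.cast_nonneg (α := ℝ) ⌊t / (L + 1)⌋₊)
    push_cast
    linarith
  · exact le_add_of_nonneg_right (Nat.cast_nonneg _)

variable [BorelSpace X]

theorem IsFlow.ae_limsup_infoRate_le (hφ : IsFlow φ) (hfp : FixedPointFree φ) {μ : Measure X}
    [IsProbabilityMeasure μ] (hinv : FlowInvariant φ μ) {k : ℕ} {P : X → Fin k}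
    (hP : Measurable P) :
    ∀ᵐ x ∂μ, limsup (infoRate μ (φ 1) P x) atTop ≤ lowerLocalEnt μ φ x := by
  have hrat : ∀ a b : ℚ, 0 ≤ a → a < b → ∀ᵐ x ∂μ, ¬ (lowerLocalEnt μ φ x < ENNReal.ofReal a ∧
      ENNReal.ofReal b < limsup (infoRate μ (φ 1) P x) atTop) := by
    intro a b ha hab
    have ha' : (0 : ℝ) ≤ a := by exact_mod_cast ha
    have hκ : (0 : ℝ) < (b - a) / 10 := by
      have : (a : ℝ) < b := by exact_mod_cast hab
      linarith
    obtain ⟨δ, hδ, h⟩ := exists_measure_richSet_le (hφ.continuous 1) (hinv 1) hP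
      (add_nonneg ha' hκ.le) hκ
    rw [show (a : ℝ) + (b - a) / 10 + 9 * ((b - a) / 10) = b by ring] at h
    rw [ae_iff]
    simp only [not_not]
    refine nonpos_iff_eq_zero.1 (ENNReal.le_of_forall_pos_le_add fun ρ hρ _ => ?_)
    obtain ⟨ε, hε, hψ⟩ := h ρ hρ
    obtain ⟨ψ, hψc, hrich⟩ := hφ.exists_shifts_mem_richSet hfp μ ha' hκ hδ hε
    rw [zero_add, ← ENNReal.ofReal_coe_nnreal]
    exact (measure_mono fun x (hx : _ ∧ _) => And.intro (hrich x hx.1) hx.2).trans (hψ ψ hψc)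
  filter_upwards [ae_all_iff.2 fun a => ae_all_iff.2 fun b => ae_all_iff.2 fun ha =>
    ae_all_iff.2 fun hab => hrat a b ha hab] with x hx
  by_contra! hlt
  obtain ⟨a, ha, hxa, hal⟩ := ENNReal.lt_iff_exists_rat_btwn.1 hlt
  obtain ⟨b, hb, hab, hbl⟩ := ENNReal.lt_iff_exists_rat_btwn.1 hal
  refine hx a b ha ?_ ⟨hxa, hbl⟩
  have := (ENNReal.ofReal_lt_ofReal_iff_of_nonneg (by exact_mod_cast ha)).1 hab
  exact_mod_cast this

end LowerEstimate

section UpperEstimate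

variable [MetricSpace X] [CompactSpace X] [MeasurableSpace X] [BorelSpace X] {φ : ℝ → X → X}

/-- Finite measurable partitions into pieces of small diameter. -/
theorem exists_partition_dist_lt {δ : ℝ} (hδ : 0 < δ) :
    ∃ (k : ℕ) (P : X → Fin k), Measurable P ∧ ∀ x y, P x = P y → dist x y < δ := by
  rcases isEmpty_or_nonempty X with h | h
  · exact ⟨1, fun _ => 0, measurable_const, fun x => h.elim x⟩
  have hcover : (univ : Set X) ⊆ ⋃ n, Metric.ball (TopologicalSpace.denseSeq X n) (δ / 2) :=
    fun x _ => by
      obtain ⟨n, hn⟩ := (TopologicalSpace.denseRange_denseSeq X).exists_dist_lt x (half_pos hδ)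
      exact mem_iUnion.2 ⟨n, hn⟩
  set e := TopologicalSpace.denseSeq X
  obtain ⟨F, hF⟩ := isCompact_univ.elim_finite_subcover _ (fun n => Metric.isOpen_ball) hcover
  set N := F.sup id
  have hclose : ∀ x, dist (e (SimpleFunc.nearestPtInd e N x)) x < δ / 2 := fun x => by
    obtain ⟨n, hnF, hn⟩ := mem_iUnion₂.1 (hF (mem_univ x))
    have := SimpleFunc.edist_nearestPt_le e x (Finset.le_sup (f := id) hnF : n ≤ N)
    rw [edist_dist, edist_dist, ENNReal.ofReal_le_ofReal_iff dist_nonneg] at this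
    exact this.trans_lt (by rwa [dist_comm])
  refine ⟨N + 1, fun x => ⟨SimpleFunc.nearestPtInd e N x,
    Nat.lt_succ_of_le (SimpleFunc.nearestPtInd_le e N x)⟩, ?_, fun x y hxy => ?_⟩
  · refine measurable_to_countable' fun i => ?_
    convert (SimpleFunc.nearestPtInd e N).measurableSet_fiber i using 1
    ext x
    simp [Fin.ext_iff]
  · have hxy' := Fin.mk.inj hxy
    have hx := hclose x
    have hy := hclose y
    rw [← hxy', dist_comm] at hy
    rw [dist_comm] at hx
    linarith [dist_triangle x (e (SimpleFunc.nearestPtInd e N x)) y,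
      dist_comm y (e (SimpleFunc.nearestPtInd e N x))]

theorem IsFlow.exists_partition_cyl_subset (hφ : IsFlow φ) {ε : ℝ} (hε : 0 < ε) :
    ∃ (k : ℕ) (P : X → Fin k), Measurable P ∧ ∀ x (n : ℕ) (t : ℝ), 1 ≤ n → t ≤ n →
      cyl (φ 1) P n x ⊆ reparBall φ x t ε := by
  obtain ⟨δ, hδ, h⟩ := hφ.exists_uniform 1 hε
  obtain ⟨k, P, hP, hPδ⟩ := exists_partition_dist_lt (X := X) hδ
  refine ⟨k, P, hP, fun x n t hn htn y hy => ⟨id, ⟨continuousOn_id, injOn_id _, rfl⟩, ?_⟩⟩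
  intro s hs
  obtain ⟨j, hj, hjs, hsj⟩ : ∃ j < n, (j : ℝ) ≤ s ∧ s ≤ j + 1 := by
    rcases lt_or_ge ⌊s⌋₊ n with hlt | hge
    · exact ⟨⌊s⌋₊, hlt, Nat.floor_le hs.1, (Nat.lt_floor_add_one s).le⟩
    · have := (Nat.le_floor_iff hs.1).1 hge
      refine ⟨n - 1, by omega, ?_, ?_⟩ <;> rw [Nat.cast_sub hn] <;> push_cast <;>
        linarith [hs.2]
  have hj' : P ((φ 1)^[j] y) = P ((φ 1)^[j] x) := congrFun hy ⟨j, hj⟩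
  have := h (s - j) ⟨by linarith, by linarith⟩ (s - j) ⟨by linarith, by linarith⟩ _ _
    (by simpa using hδ) (hPδ _ _ hj'.symm)
  rwa [hφ.iterate_one, hφ.iterate_one, ← hφ.map_add, ← hφ.map_add, sub_add_cancel] at this

end UpperEstimate

theorem negLogNN_mul_self {p : ℝ≥0∞} (hp : p ≤ 1) :
    negLogNN p * p = ENNReal.ofReal (Real.negMulLog p.toReal) := by
  unfold negLogNN
  split_ifs with h
  · simp [h]
  · nth_rw 2 [← ENNReal.ofReal_toReal (hp.trans_lt ENNReal.one_lt_top).ne]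
    rw [← ENNReal.ofReal_mul' ENNReal.toReal_nonneg, Real.negMulLog]
    congr 1
    ring

theorem negLogNN_mul_self_le {p : ℝ≥0∞} (hp : p ≠ ⊤) {c : ℝ} (hc : 0 ≤ c) :
    negLogNN p * p ≤ min (negLogNN p) (ENNReal.ofReal c) * p + expNeg c := by
  rcases le_total (negLogNN p) (ENNReal.ofReal c) with h | h
  · rw [min_eq_left h]
    exact le_self_add
  rw [min_eq_right h]
  unfold negLogNN
  split_ifs with h0
  · simp [h0]
  have hpos : 0 < p.toReal := ENNReal.toReal_pos h0 hp
  nth_rw 2 3 [← ENNReal.ofReal_toReal hp]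
  rw [← ENNReal.ofReal_mul' hpos.le, ← ENNReal.ofReal_mul' hpos.le, expNeg,
    ← ENNReal.ofReal_add (by positivity) (Real.exp_pos _).le]
  refine ENNReal.ofReal_le_ofReal ?_
  have h1 := Real.add_one_le_exp (-Real.log p.toReal - c)
  have h2 : p.toReal * Real.exp (-Real.log p.toReal - c) = Real.exp (-c) := by
    rw [sub_eq_add_neg, Real.exp_add, Real.exp_neg, Real.exp_log hpos]
    field_simp
  rw [← h2]
  nlinarith

section Integral

variable [MeasurableSpace X] {μ : Measure X} {T : X → X} {k : ℕ}
  {P : X → Fin k}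

theorem measurable_comp_cyl (hT : Measurable T) (hP : Measurable P) (G : ℝ≥0∞ → ℝ≥0∞) (n : ℕ) :
    Measurable fun x => G (μ (cyl T P n x)) :=
  (Measurable.of_discrete (f := fun w : Fin n → Fin k => G (μ (itin T P n ⁻¹' {w})))).comp
    (measurable_itin hT hP n)

theorem measurable_infoRate (hT : Measurable T) (hP : Measurable P) (n : ℕ) :
    Measurable fun x => infoRate μ T P x n :=
  measurable_comp_cyl hT hP (fun p => negLogNN p / n) n

theorem lintegral_comp_cyl (hT : Measurable T) (hP : Measurable P) (G : ℝ≥0∞ → ℝ≥0∞) (n : ℕ) :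
    ∫⁻ x, G (μ (cyl T P n x)) ∂μ =
      ∑ w, G (μ (itin T P n ⁻¹' {w})) * μ (itin T P n ⁻¹' {w}) := by
  have h := lintegral_map (μ := μ) (f := fun w : Fin n → Fin k => G (μ (itin T P n ⁻¹' {w})))
    Measurable.of_discrete (measurable_itin hT hP n)
  refine h.symm.trans ?_
  rw [lintegral_fintype]
  refine Finset.sum_congr rfl fun w _ => ?_
  rw [Measure.map_apply (measurable_itin hT hP n) (measurableSet_singleton w)]

variable [IsProbabilityMeasure μ]

theorem lintegral_infoRate (hT : Measurable T) (hP : Measurable P) {n : ℕ} (hn : 1 ≤ n) :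
    ∫⁻ x, infoRate μ T P x n ∂μ = ENNReal.ofReal (partEnt μ (itin T P n) / n) := by
  have h : ∫⁻ x, negLogNN (μ (cyl T P n x)) ∂μ = ENNReal.ofReal (partEnt μ (itin T P n)) := by
    rw [lintegral_comp_cyl hT hP, partEnt, ENNReal.ofReal_sum_of_nonneg fun w _ =>
      Real.negMulLog_nonneg ENNReal.toReal_nonneg
        (ENNReal.toReal_le_of_le_ofReal zero_le_one (by simpa using prob_le_one))]
    exact Finset.sum_congr rfl fun w _ => negLogNN_mul_self prob_le_one
  simp only [infoRate, div_eq_mul_inv]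
  rw [lintegral_mul_const _ (measurable_comp_cyl hT hP _ n), h, ← div_eq_mul_inv,
    ← div_eq_mul_inv, ENNReal.ofReal_div_of_pos (by exact_mod_cast hn), ENNReal.ofReal_natCast]

theorem lintegral_infoRate_le (hT : Measurable T) (hP : Measurable P) {n : ℕ} (hn : 1 ≤ n) :
    ∫⁻ x, infoRate μ T P x n ∂μ ≤ ∫⁻ x, min (infoRate μ T P x n) k ∂μ + (n : ℝ≥0∞)⁻¹ := by
  have hn0 : (n : ℝ≥0∞) ≠ 0 := by exact_mod_cast (by omega : n ≠ 0)
  have hcount : (k : ℝ≥0∞) ^ n * expNeg (k * n) ≤ 1 := by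
    have h1 : (k : ℝ≥0∞) * expNeg k ≤ 1 := by
      rw [expNeg, ← ENNReal.ofReal_natCast, ← ENNReal.ofReal_mul (Nat.cast_nonneg k),
        ENNReal.ofReal_le_one, Real.exp_neg, ← div_eq_mul_inv, div_le_one (Real.exp_pos _)]
      linarith [Real.add_one_le_exp (k : ℝ)]
    have h2 : expNeg (k * n) = expNeg k ^ n := by
      rw [expNeg, expNeg, ← ENNReal.ofReal_pow (Real.exp_pos _).le, ← Real.exp_nat_mul]
      ring_nf
    rw [h2, ← mul_pow]
    exact pow_le_one₀ zero_le h1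
  have h : ∫⁻ x, negLogNN (μ (cyl T P n x)) ∂μ ≤
      ∫⁻ x, min (negLogNN (μ (cyl T P n x))) (ENNReal.ofReal (k * n)) ∂μ + 1 := by
    rw [lintegral_comp_cyl hT hP, lintegral_comp_cyl hT hP
      fun p => min (negLogNN p) (ENNReal.ofReal (k * n))]
    refine (Finset.sum_le_sum fun w _ => negLogNN_mul_self_le (measure_ne_top μ _)
      (by positivity : (0 : ℝ) ≤ k * n)).trans ?_
    rw [Finset.sum_add_distrib]
    gcongr
    simpa using hcount
  have hmin : ∀ x, min (infoRate μ T P x n) k =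
      min (negLogNN (μ (cyl T P n x))) (ENNReal.ofReal (k * n)) * (n : ℝ≥0∞)⁻¹ := by
    intro x
    rw [min_mul, infoRate, div_eq_mul_inv, ENNReal.ofReal_mul (Nat.cast_nonneg k),
      ENNReal.ofReal_natCast, ENNReal.ofReal_natCast, mul_assoc,
      ENNReal.mul_inv_cancel hn0 (ENNReal.natCast_ne_top n), mul_one]
  simp only [hmin]
  simp only [infoRate, div_eq_mul_inv]
  rw [lintegral_mul_const _ (measurable_comp_cyl hT hP _ n), lintegral_mul_const _
    (measurable_comp_cyl hT hP (fun p => min (negLogNN p) (ENNReal.ofReal (k * n))) n)]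
  refine (mul_le_mul' h le_rfl).trans_eq ?_
  rw [add_mul, one_mul]

theorem lintegral_liminf_infoRate_le (hT : Measurable T) (hP : Measurable P) :
    ∫⁻ x, liminf (infoRate μ T P x) atTop ∂μ ≤ kolSinai μ T := by
  refine (lintegral_liminf_le (measurable_infoRate hT hP)).trans ?_
  refine le_trans (liminf_le_limsup (by isBoundedDefault) (by isBoundedDefault)) ?_
  refine le_trans (le_of_eq (limsup_congr ?_)) (le_iSup_of_le k (le_iSup₂_of_le P hP le_rfl))
  filter_upwards [eventually_ge_atTop 1] with n hn
  exact lintegral_infoRate hT hP hn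

theorem limsup_partEnt_le (hT : Measurable T) (hP : Measurable P) :
    limsup (fun n : ℕ => ENNReal.ofReal (partEnt μ (itin T P n) / n)) atTop ≤
      ∫⁻ x, limsup (infoRate μ T P x) atTop ∂μ := by
  have h1 : limsup (fun n : ℕ => ENNReal.ofReal (partEnt μ (itin T P n) / n)) atTop ≤
      limsup ((fun n : ℕ => ∫⁻ x, min (infoRate μ T P x n) k ∂μ) +
        fun n : ℕ => (n : ℝ≥0∞)⁻¹) atTop := by
    refine limsup_le_limsup ?_
    filter_upwards [eventually_ge_atTop 1] with n hn
    rw [← lintegral_infoRate hT hP hn]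
    exact lintegral_infoRate_le hT hP hn
  rw [ENNReal.limsup_add_of_right_tendsto_zero ENNReal.tendsto_inv_nat_nhds_zero] at h1
  refine h1.trans ((limsup_lintegral_le (fun _ => (k : ℝ≥0∞))
    (fun n => (measurable_infoRate hT hP n).min measurable_const)
    (fun n => Eventually.of_forall fun x => min_le_right _ _) (by simp)).trans ?_)
  exact lintegral_mono fun x => limsup_le_limsup (Eventually.of_forall fun n => min_le_left _ _)

end Integral

section LocalRate

variable [PseudoMetricSpace X] [MeasurableSpace X] {μ : Measure X} [IsProbabilityMeasure μ]
  {φ : ℝ → X → X} {k : ℕ} {P : X → Fin k} {ε : ℝ} {x : X}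

theorem liminf_localRate_le
    (h : ∀ n : ℕ, 1 ≤ n → ∀ t : ℝ, t ≤ n → cyl (φ 1) P n x ⊆ reparBall φ x t ε) :
    liminf (fun t : ℝ => localRate μ φ x ε t) atTop ≤ liminf (infoRate μ (φ 1) P x) atTop := by
  refine (tendsto_natCast_atTop_atTop.liminf_le_liminf_comp).trans (liminf_le_liminf ?_)
  filter_upwards [eventually_ge_atTop 1] with n hn
  simp only [Function.comp_apply, localRate, infoRate, ENNReal.ofReal_natCast]
  gcongr
  exact negLogNN_anti (measure_mono (h n hn n le_rfl)) (measure_ne_top μ _)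

theorem limsup_localRate_le
    (h : ∀ n : ℕ, 1 ≤ n → ∀ t : ℝ, t ≤ n → cyl (φ 1) P n x ⊆ reparBall φ x t ε) :
    limsup (fun t : ℝ => localRate μ φ x ε t) atTop ≤ limsup (infoRate μ (φ 1) P x) atTop := by
  refine le_of_forall_gt_imp_ge_of_dense fun c hc => ?_
  obtain ⟨c₁, hc₁, hc₁c⟩ := ENNReal.lt_iff_exists_nnreal_btwn.1 hc
  obtain ⟨c₂, hc₂, hc₂c⟩ := ENNReal.lt_iff_exists_nnreal_btwn.1 hc₁c
  have hlt : (c₁ : ℝ) < c₂ := by exact_mod_cast hc₂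
  have hev := (tendsto_nat_ceil_atTop (α := ℝ)).eventually
    ((eventually_lt_of_limsup_lt hc₁).and (eventually_ge_atTop 1))
  refine (limsup_le_of_le (by isBoundedDefault) ?_).trans hc₂c.le
  filter_upwards [hev, eventually_gt_atTop 0,
    eventually_ge_atTop ((c₁ : ℝ) / (c₂ - c₁))] with t ht ht0 htc
  obtain ⟨hrate, hn⟩ := ht
  rw [div_le_iff₀ (by linarith)] at htc
  have hn0 : (⌈t⌉₊ : ℝ≥0∞) ≠ 0 := by exact_mod_cast (by omega : ⌈t⌉₊ ≠ 0)
  have h1 := (ENNReal.div_le_iff_le_mul (Or.inl hn0) (Or.inl (ENNReal.natCast_ne_top _))).1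
    hrate.le
  refine ENNReal.div_le_of_le_mul ?_
  refine (negLogNN_anti (measure_mono (h _ hn t (Nat.le_ceil t))) (measure_ne_top μ _)).trans
    (h1.trans ?_)
  rw [← ENNReal.ofReal_natCast, ← ENNReal.ofReal_coe_nnreal, ← ENNReal.ofReal_coe_nnreal,
    ← ENNReal.ofReal_mul c₁.coe_nonneg, ← ENNReal.ofReal_mul c₂.coe_nonneg]
  refine ENNReal.ofReal_le_ofReal ?_
  have h2 := mul_le_mul_of_nonneg_left (Nat.ceil_lt_add_one ht0.le).le c₁.coe_nonneg
  linarith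

end LocalRate

theorem lowerLocalEnt_le_upperLocalEnt [PseudoMetricSpace X] [MeasurableSpace X] (μ : Measure X)
    (φ : ℝ → X → X) (x : X) : lowerLocalEnt μ φ x ≤ upperLocalEnt μ φ x :=
  iSup₂_mono fun _ _ => liminf_le_limsup

/-- **Brin–Katok entropy formula for flows (non-ergodic case).** For a compact metric
flow without fixed points and any `φ`-invariant Borel probability measure `μ`,
`∫ underline h_μ(φ,·) dμ = ∫ overline h_μ(φ,·) dμ = h_μ(φ₁)`, and the upper and lower
local entropies agree `μ`-almost everywhere. -/
theorem brinKatok_flow {X : Type*} [MetricSpace X] [CompactSpace X]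
    [MeasurableSpace X] [BorelSpace X] (φ : ℝ → X → X) (hφ : IsFlow φ)
    (hfp : FixedPointFree φ) (μ : Measure X) [IsProbabilityMeasure μ]
    (hinv : FlowInvariant φ μ) :
    (∫⁻ x, lowerLocalEnt μ φ x ∂μ = kolSinai μ (φ 1)) ∧
    (∫⁻ x, upperLocalEnt μ φ x ∂μ = kolSinai μ (φ 1)) ∧
    (∀ᵐ x ∂μ, upperLocalEnt μ φ x = lowerLocalEnt μ φ x) := by
  have hT : Measurable (φ 1) := (hφ.continuous 1).measurable
  choose k P hP hcyl using fun j : ℕ =>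
    hφ.exists_partition_cyl_subset (Nat.one_div_pos_of_nat (α := ℝ) (n := j))
  have hcyl' : ∀ (j : ℕ) (ε : ℝ), 1 / (j + 1 : ℝ) ≤ ε → ∀ x (n : ℕ), 1 ≤ n → ∀ t : ℝ, t ≤ n →
      cyl (φ 1) (P j) n x ⊆ reparBall φ x t ε := by
    intro j ε hj x n hn t ht y hy
    obtain ⟨α, hα, hclose⟩ := hcyl j x n t hn ht hy
    exact ⟨α, hα, fun s hs => (hclose s hs).trans_le hj⟩
  have hsmall : ∀ ε : ℝ, 0 < ε → ∀ᶠ j : ℕ in atTop, 1 / (j + 1 : ℝ) ≤ ε := fun ε hε =>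
    tendsto_one_div_add_atTop_nhds_zero_nat.eventually (eventually_le_nhds hε)
  have hae : ∀ᵐ x ∂μ, upperLocalEnt μ φ x = lowerLocalEnt μ φ x := by
    filter_upwards [ae_all_iff.2 fun j => hφ.ae_limsup_infoRate_le hfp hinv (hP j)] with x hx
    refine le_antisymm (iSup₂_le fun ε hε => ?_) (lowerLocalEnt_le_upperLocalEnt μ φ x)
    obtain ⟨j, hj⟩ := (hsmall ε hε).exists
    exact (limsup_localRate_le (hcyl' j ε hj x)).trans (hx j)
  have hle : ∫⁻ x, lowerLocalEnt μ φ x ∂μ ≤ kolSinai μ (φ 1) := by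
    have hpt : ∀ x, lowerLocalEnt μ φ x ≤
        liminf (fun j => liminf (infoRate μ (φ 1) (P j) x) atTop) atTop := fun x =>
      iSup₂_le fun ε hε => le_liminf_of_le (by isBoundedDefault)
        ((hsmall ε hε).mono fun j hj => liminf_localRate_le (hcyl' j ε hj x))
    refine (lintegral_mono hpt).trans ((lintegral_liminf_le fun j =>
      Measurable.liminf (measurable_infoRate hT (hP j))).trans ?_)
    exact liminf_le_of_le (by isBoundedDefault) fun b hb =>
      let ⟨j, hj⟩ := hb.exists
      hj.trans (lintegral_liminf_infoRate_le hT (hP j))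
  have hge : kolSinai μ (φ 1) ≤ ∫⁻ x, lowerLocalEnt μ φ x ∂μ :=
    iSup_le fun m => iSup₂_le fun Q hQ => (limsup_partEnt_le hT hQ).trans
      (lintegral_mono_ae (hφ.ae_limsup_infoRate_le hfp hinv hQ))
  have hlower := hle.antisymm hge
  exact ⟨hlower, (lintegral_congr_ae hae).trans hlower, hae⟩

end FlowEntropy
end

section
/- Let (X,d) be a compact metric space, φ a continuous flow on X, and μ a φ-invariant Borel probability measure. Then for every τ∈ℝ\{0}, ∫_X overline h_μ(φ,x) dμ(x) ≤ (1/|τ|) h_μ(φ_τ), where h_μ(φ_τ) is the measure-theoretic entropy of the time-τ map φ_τ with respect to μ. -/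
open MeasureTheory Filter Set Topology
open scoped ENNReal NNReal

namespace FlowEntropy

variable {X : Type*}

lemma limsup_birkhoffSum_div_le_comp (S : X → X) (f : X → ℝ≥0∞) (hf : ∀ x, f x ≠ ⊤) (x : X) :
    limsup (fun n : ℕ => birkhoffSum S f n x / n) atTop ≤
      limsup (fun n : ℕ => birkhoffSum S f n (S x) / n) atTop := by
  rw [← limsup_nat_add _ 1]
  have hlim : Tendsto (fun n : ℕ => f x / ((n + 1 : ℕ) : ℝ≥0∞)) atTop (𝓝 0) := by
    simpa [Function.comp_def] using (ENNReal.Tendsto.const_div ENNReal.tendsto_nat_nhds_top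
      (Or.inr (hf x))).comp (tendsto_add_atTop_nat 1)
  refine (limsup_le_limsup (Eventually.of_forall fun n => ?_)).trans_eq
    (ENNReal.limsup_add_of_left_tendsto_zero hlim _)
  simp only [Pi.add_apply]
  rw [birkhoffSum_succ', ENNReal.add_div]
  exact add_le_add le_rfl (ENNReal.div_le_div_left (Nat.cast_le.2 n.le_succ) _)

lemma exists_mul_limsup_birkhoffSum_le (S : X → X) (f : X → ℝ≥0∞) (x : X)
    (hg : limsup (fun n : ℕ => birkhoffSum S f n x / n) atTop ≠ ⊤) {ε : ℝ≥0∞} (hε : ε ≠ 0) :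
    ∃ n : ℕ, 1 ≤ n ∧ n * limsup (fun n : ℕ => birkhoffSum S f n x / n) atTop ≤
      birkhoffSum S f n x + n * ε := by
  set g := limsup (fun n : ℕ => birkhoffSum S f n x / n) atTop with hgdef
  rcases eq_or_ne g 0 with h0 | h0
  · exact ⟨1, le_rfl, by simp [h0]⟩
  · have hlt : g - ε < g := ENNReal.sub_lt_self hg h0 hε
    obtain ⟨n, hn, h1⟩ :=
      ((frequently_lt_of_lt_limsup (by isBoundedDefault) hlt).and_eventually
        (eventually_ge_atTop 1)).exists
    refine ⟨n, h1, ?_⟩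
    have hn0 : (n : ℝ≥0∞) ≠ 0 := by exact_mod_cast (by omega : n ≠ 0)
    calc (n : ℝ≥0∞) * g ≤ n * (birkhoffSum S f n x / n + ε) := by
          gcongr
          exact tsub_le_iff_right.1 hn.le
      _ = birkhoffSum S f n x + n * ε := by
          rw [mul_add, ENNReal.mul_div_cancel hn0 (ENNReal.natCast_ne_top n)]

/-- If from every point one of the first `L` Birkhoff sums of `F` dominates the
corresponding multiple of `g`, and `g` is bounded and nondecreasing along orbits, then every
Birkhoff sum of `F` dominates that multiple up to a bounded error. -/
lemma mul_le_birkhoffSum_add (S : X → X) {F g : X → ℝ≥0∞} {M : ℝ≥0∞} {L : ℕ}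
    (hgS : ∀ x, g x ≤ g (S x)) (hgM : ∀ x, g x ≤ M)
    (hL : ∀ x, ∃ r : ℕ, 1 ≤ r ∧ r ≤ L ∧ r * g x ≤ birkhoffSum S F r x) (n : ℕ) (x : X) :
    n * g x ≤ birkhoffSum S F n x + L * M := by
  induction n using Nat.strong_induction_on generalizing x with
  | _ n ih =>
    rcases le_or_gt n L with h | h
    · calc (n : ℝ≥0∞) * g x ≤ L * M := by gcongr; exact hgM x
        _ ≤ _ := le_add_self
    · obtain ⟨r, hr1, hrL, hr⟩ := hL x
      obtain ⟨k, rfl⟩ := Nat.exists_eq_add_of_le (hrL.trans h.le)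
      have hmono : g x ≤ g (S^[r] x) := by
        clear hr hrL hr1 ih h
        induction r with
        | zero => simp
        | succ r ihr => rw [Function.iterate_succ_apply']; exact ihr.trans (hgS _)
      calc ((r + k : ℕ) : ℝ≥0∞) * g x = r * g x + k * g x := by push_cast; ring
        _ ≤ birkhoffSum S F r x + k * g (S^[r] x) := by gcongr
        _ ≤ birkhoffSum S F r x + (birkhoffSum S F k (S^[r] x) + L * M) := by
            gcongr; exact ih k (by omega) _
        _ = _ := by rw [birkhoffSum_add, add_assoc]

section Birkhoff

variable [MeasurableSpace X]

lemma measurable_birkhoffSum {S : X → X} {f : X → ℝ≥0∞} (hS : Measurable S)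
    (hf : Measurable f) (n : ℕ) : Measurable (birkhoffSum S f n) := by
  unfold birkhoffSum
  exact Finset.measurable_fun_sum _ fun i _ => hf.comp (hS.iterate i)

lemma lintegral_birkhoffSum {μ : Measure X} {S : X → X} {f : X → ℝ≥0∞}
    (hS : MeasurePreserving S μ μ) (hf : Measurable f) (n : ℕ) :
    ∫⁻ x, birkhoffSum S f n x ∂μ = n * ∫⁻ x, f x ∂μ := by
  unfold birkhoffSum
  have hmeas : ∀ i ∈ Finset.range n, Measurable fun x => f (S^[i] x) :=
    fun i _ => hf.comp (hS.measurable.iterate i)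
  rw [lintegral_finsetSum _ hmeas]
  simp [(hS.iterate _).lintegral_comp hf]

lemma le_of_forall_nat_mul_le {a b c : ℝ≥0∞} (hc : c ≠ ⊤)
    (h : ∀ n : ℕ, n * a ≤ n * b + c) : a ≤ b := by
  have hlim : Tendsto (fun n : ℕ => b + c / (n : ℝ≥0∞)) atTop (𝓝 (b + 0)) := by
    refine tendsto_const_nhds.add ?_
    simpa using ENNReal.Tendsto.const_div ENNReal.tendsto_nat_nhds_top (Or.inr hc)
  rw [add_zero] at hlim
  refine ge_of_tendsto hlim ?_
  filter_upwards [eventually_ge_atTop 1] with n hn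
  have hn0 : (n : ℝ≥0∞) ≠ 0 := by exact_mod_cast (by omega : n ≠ 0)
  have hnt := ENNReal.natCast_ne_top n
  calc a = n * a / n := by rw [mul_comm, ENNReal.mul_div_cancel_right hn0 hnt]
    _ ≤ (n * b + c) / n := by gcongr; exact h n
    _ = b + c / n := by rw [ENNReal.add_div, mul_comm, ENNReal.mul_div_cancel_right hn0 hnt]

/-- The upper half of Birkhoff's ergodic theorem for bounded nonnegative functions. -/
theorem lintegral_limsup_birkhoffSum_le {μ : Measure X} [IsProbabilityMeasure μ] {S : X → X}
    {f : X → ℝ≥0∞} {M : ℝ≥0∞} (hS : MeasurePreserving S μ μ) (hf : Measurable f)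
    (hM : M ≠ ⊤) (hfM : ∀ x, f x ≤ M) :
    ∫⁻ x, limsup (fun n : ℕ => birkhoffSum S f n x / n) atTop ∂μ ≤ ∫⁻ x, f x ∂μ := by
  set g : X → ℝ≥0∞ := fun x => limsup (fun n : ℕ => birkhoffSum S f n x / n) atTop with hg
  have hgmeas : Measurable g :=
    Measurable.limsup fun n => (measurable_birkhoffSum hS.measurable hf n).div_const _
  have hgS : ∀ x, g x ≤ g (S x) :=
    limsup_birkhoffSum_div_le_comp S f fun x => ne_top_of_le_ne_top hM (hfM x)
  have hgM : ∀ x, g x ≤ M := fun x => by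
    refine limsup_le_of_le (by isBoundedDefault) (Eventually.of_forall fun n => ?_)
    refine ENNReal.div_le_of_le_mul ?_
    calc birkhoffSum S f n x ≤ ∑ _i ∈ Finset.range n, M := Finset.sum_le_sum fun i _ => hfM _
      _ = M * n := by simp [mul_comm]
  refine ENNReal.le_of_forall_pos_le_add fun ε hε _ => ?_
  have hε' : (ε : ℝ≥0∞) ≠ 0 := by exact_mod_cast hε.ne'
  let E : ℕ → Set X := fun L =>
    {x | ∀ n : ℕ, 1 ≤ n → n ≤ L → birkhoffSum S f n x + n * ε < n * g x}
  have hEmeas : ∀ L, MeasurableSet (E L) := fun L => by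
    simp only [E, ofPred_forall]
    refine MeasurableSet.iInter fun n => MeasurableSet.iInter fun _ => MeasurableSet.iInter fun _ =>
      measurableSet_lt ?_ (hgmeas.const_mul _)
    exact (measurable_birkhoffSum hS.measurable hf n).add_const _
  have hEanti : Antitone E := fun a b hab x hx n h1 h2 => hx n h1 (h2.trans hab)
  have hEempty : ⋂ L, E L = ∅ := by
    refine eq_empty_of_forall_notMem fun x hx => ?_
    obtain ⟨n, h1, hn⟩ := exists_mul_limsup_birkhoffSum_le S f x
      (ne_top_of_le_ne_top hM (hgM x)) hε'
    exact (mem_iInter.1 hx n n h1 le_rfl).not_ge hn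
  have hEtend : Tendsto (fun L => ∫⁻ x, f x ∂μ + ε + M * μ (E L)) atTop
      (𝓝 (∫⁻ x, f x ∂μ + ε + M * 0)) := by
    refine tendsto_const_nhds.add (ENNReal.Tendsto.const_mul ?_ (Or.inr hM))
    have := tendsto_measure_iInter_atTop (μ := μ) (fun L => (hEmeas L).nullMeasurableSet) hEanti
      ⟨0, measure_ne_top _ _⟩
    rwa [hEempty, measure_empty] at this
  rw [mul_zero, add_zero] at hEtend
  refine ge_of_tendsto hEtend ?_
  filter_upwards [eventually_ge_atTop 1] with L hL
  let F : X → ℝ≥0∞ := fun x => f x + ε + (E L).indicator (fun _ => M) x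
  have hFmeas : Measurable F := (hf.add_const _).add (measurable_const.indicator (hEmeas L))
  have hFint : ∫⁻ x, F x ∂μ = ∫⁻ x, f x ∂μ + ε + M * μ (E L) := by
    rw [lintegral_add_left (hf.add_const _), lintegral_add_left hf,
      lintegral_indicator_const (hEmeas L)]
    simp
  rw [← hFint]
  have hblock : ∀ x, ∃ r : ℕ, 1 ≤ r ∧ r ≤ L ∧ r * g x ≤ birkhoffSum S F r x := fun x => by
    by_cases hx : x ∈ E L
    · refine ⟨1, le_rfl, hL, ?_⟩
      simp only [Nat.cast_one, one_mul, birkhoffSum_one]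
      exact (hgM x).trans (by simp [F, hx])
    · simp only [E, mem_ofPred_eq, not_forall, not_lt] at hx
      obtain ⟨n, h1, h2, h3⟩ := hx
      refine ⟨n, h1, h2, h3.trans ?_⟩
      calc birkhoffSum S f n x + n * ε = birkhoffSum S (fun x => f x + ε) n x := by
            simp [birkhoffSum, Finset.sum_add_distrib]
        _ ≤ birkhoffSum S F n x := Finset.sum_le_sum fun i _ => le_self_add
  refine le_of_forall_nat_mul_le (ENNReal.mul_ne_top (ENNReal.natCast_ne_top L) hM) fun n => ?_
  calc n * ∫⁻ x, g x ∂μ = ∫⁻ x, n * g x ∂μ := (lintegral_const_mul _ hgmeas).symm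
    _ ≤ ∫⁻ x, (birkhoffSum S F n x + L * M) ∂μ :=
        lintegral_mono (mul_le_birkhoffSum_add S hgS hgM hblock n)
    _ = n * ∫⁻ x, F x ∂μ + L * M := by
        rw [lintegral_add_left (measurable_birkhoffSum hS.measurable hFmeas n),
          lintegral_birkhoffSum hS hFmeas]
        simp

end Birkhoff

lemma negLogNN_anti_s7 {a b : ℝ≥0∞} (hab : a ≤ b) (hb : b ≠ ⊤) : negLogNN b ≤ negLogNN a := by
  rcases eq_or_ne a 0 with rfl | ha
  · simp [negLogNN]
  · have hb0 : b ≠ 0 := (pos_of_ne_zero ha |>.trans_le hab).ne'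
    rw [negLogNN, negLogNN, if_neg ha, if_neg hb0]
    refine ENNReal.ofReal_le_ofReal (neg_le_neg (Real.log_le_log ?_ ?_))
    · exact ENNReal.toReal_pos ha (ne_top_of_le_ne_top hb hab)
    · exact ENNReal.toReal_mono hb hab

lemma negLogNN_mul_le {a b : ℝ≥0∞} (ha : a ≠ ⊤) (hb : b ≠ ⊤) :
    negLogNN (a * b) ≤ negLogNN a + negLogNN b := by
  rcases eq_or_ne a 0 with rfl | ha0
  · simp [negLogNN]
  rcases eq_or_ne b 0 with rfl | hb0
  · simp [negLogNN]
  rw [negLogNN, negLogNN, negLogNN, if_neg ha0, if_neg hb0, if_neg (mul_ne_zero ha0 hb0),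
    ENNReal.toReal_mul, Real.log_mul (ENNReal.toReal_pos ha0 ha).ne'
      (ENNReal.toReal_pos hb0 hb).ne', neg_add]
  exact ENNReal.ofReal_add_le

lemma negLogNN_prod_le {ι : Type*} (s : Finset ι) {a : ι → ℝ≥0∞} (ha : ∀ i, a i ≠ ⊤) :
    negLogNN (∏ i ∈ s, a i) ≤ ∑ i ∈ s, negLogNN (a i) := by
  classical
  induction s using Finset.induction_on with
  | empty => simp [negLogNN]
  | insert i s hi ih =>
    rw [Finset.prod_insert hi, Finset.sum_insert hi]
    exact (negLogNN_mul_le (ha i) (ENNReal.prod_ne_top fun j _ => ha j)).trans (by gcongr)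

lemma measurable_negLogNN : Measurable negLogNN :=
  Measurable.ite (measurableSet_singleton 0) measurable_const
    (Real.measurable_log.comp ENNReal.measurable_toReal).neg.ennreal_ofReal

lemma tendsto_negLogNN_inv_sq_div :
    Tendsto (fun m : ℕ => negLogNN (ENNReal.ofReal ((m : ℝ) ^ 2)⁻¹) / m) atTop (𝓝 0) := by
  have hlim : Tendsto (fun m : ℕ => ENNReal.ofReal (2 * (Real.log m / m))) atTop (𝓝 0) := by
    have h := (Real.tendsto_pow_log_div_mul_add_atTop 1 0 1 one_ne_zero).comp
      tendsto_natCast_atTop_atTop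
    simpa [Function.comp_def] using ENNReal.tendsto_ofReal (h.const_mul 2)
  refine hlim.congr' ?_
  filter_upwards [eventually_ge_atTop 1] with m hm
  have hm0 : (0 : ℝ) < m := by exact_mod_cast hm
  have hpos : (0 : ℝ) < ((m : ℝ) ^ 2)⁻¹ := by positivity
  rw [negLogNN, if_neg (ENNReal.ofReal_pos.2 hpos).ne', ENNReal.toReal_ofReal hpos.le,
    ← ENNReal.ofReal_natCast m, ← ENNReal.ofReal_div_of_pos hm0, Real.log_inv, Real.log_pow,
    neg_neg, Nat.cast_ofNat, mul_div_assoc]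

/-- The first `n` symbols of the `T`-orbit of `x` read through `P`. -/
def itinerary {ι : Type*} (T : X → X) (P : X → ι) (n : ℕ) (x : X) : Fin n → ι :=
  fun j => P (T^[(j : ℕ)] x)

section Entropy

variable [MeasurableSpace X] {ι : Type*} [MeasurableSpace ι]

lemma measurable_itinerary {T : X → X} {P : X → ι} (hT : Measurable T) (hP : Measurable P)
    (n : ℕ) : Measurable (itinerary T P n) :=
  measurable_pi_lambda _ fun j => hP.comp (hT.iterate j)

variable [Fintype ι] [MeasurableSingletonClass ι]

lemma lintegral_comp_eq_sum (μ : Measure X) {P : X → ι} (hP : Measurable P) (G : ι → ℝ≥0∞) :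
    ∫⁻ x, G (P x) ∂μ = ∑ i, G i * μ (P ⁻¹' {i}) := by
  rw [← lintegral_map (measurable_of_finite G) hP, lintegral_fintype]
  simp [Measure.map_apply hP (measurableSet_singleton _)]

lemma lintegral_ofReal_neg_log_eq_partEnt (μ : Measure X) [IsProbabilityMeasure μ] {P : X → ι}
    (hP : Measurable P) :
    ∫⁻ x, ENNReal.ofReal (-Real.log (μ (P ⁻¹' {P x})).toReal) ∂μ =
      ENNReal.ofReal (partEnt μ P) := by
  rw [lintegral_comp_eq_sum μ hP fun i => ENNReal.ofReal (-Real.log (μ (P ⁻¹' {i})).toReal),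
    partEnt, ENNReal.ofReal_sum_of_nonneg fun i _ =>
      Real.negMulLog_nonneg ENNReal.toReal_nonneg measureReal_le_one]
  refine Finset.sum_congr rfl fun i _ => ?_
  rw [← ENNReal.ofReal_toReal (measure_ne_top μ (P ⁻¹' {i})), ← ENNReal.ofReal_mul',
    ENNReal.toReal_ofReal ENNReal.toReal_nonneg, Real.negMulLog]
  · ring_nf
  · exact ENNReal.toReal_nonneg

lemma ae_measure_fiber_ne_zero (μ : Measure X) {P : X → ι} (hP : Measurable P) :
    ∀ᵐ x ∂μ, μ (P ⁻¹' {P x}) ≠ 0 := by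
  classical
  let G : ι → ℝ≥0∞ := fun i => if μ (P ⁻¹' {i}) = 0 then 1 else 0
  have h : ∫⁻ x, (G ∘ P) x ∂μ = 0 :=
    (lintegral_comp_eq_sum μ hP G).trans <| Finset.sum_eq_zero fun i _ => by
      by_cases hi : μ (P ⁻¹' {i}) = 0 <;> simp [G, hi]
  rw [lintegral_eq_zero_iff ((measurable_of_finite G).comp hP)] at h
  filter_upwards [h] with x hx h0
  simp [G, h0] at hx

/-- The product of the static probabilities along an itinerary, relative to the probability of
the itinerary itself, has integral at most one. -/
lemma lintegral_prod_div_measure_le_one {μ : Measure X} [IsProbabilityMeasure μ] {T : X → X}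
    (hT : Measurable T) {P : X → ι} (hP : Measurable P) (m : ℕ) :
    ∫⁻ x, (∏ j : Fin m, μ (P ⁻¹' {itinerary T P m x j})) /
      μ (itinerary T P m ⁻¹' {itinerary T P m x}) ∂μ ≤ 1 := by
  classical
  rw [lintegral_comp_eq_sum μ (measurable_itinerary hT hP m) fun c =>
    (∏ j : Fin m, μ (P ⁻¹' {c j})) / μ (itinerary T P m ⁻¹' {c})]
  calc _ ≤ ∑ c : Fin m → ι, ∏ j : Fin m, μ (P ⁻¹' {c j}) :=
        Finset.sum_le_sum fun c _ => by rw [mul_comm]; exact ENNReal.mul_div_le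
    _ = ∏ _j : Fin m, ∑ i, μ (P ⁻¹' {i}) := (Fintype.prod_sum fun _ i => μ (P ⁻¹' {i})).symm
    _ = 1 := by
        have h := lintegral_comp_eq_sum μ hP fun _ => 1
        simp only [lintegral_const, measure_univ, one_mul] at h
        simp [← h]

/-- Almost surely, the probability of an itinerary is at least the product of its static
probabilities, up to a polynomial factor. -/
lemma ae_eventually_prod_le_measure {μ : Measure X} [IsProbabilityMeasure μ] {T : X → X}
    (hT : Measurable T) {P : X → ι} (hP : Measurable P) :
    ∀ᵐ x ∂μ, ∀ᶠ m : ℕ in atTop,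
      ENNReal.ofReal ((m : ℝ) ^ 2)⁻¹ * ∏ j : Fin m, μ (P ⁻¹' {itinerary T P m x j}) ≤
        μ (itinerary T P m ⁻¹' {itinerary T P m x}) := by
  let R : ℕ → X → ℝ≥0∞ := fun m x => ENNReal.ofReal ((m : ℝ) ^ 2)⁻¹ *
    ((∏ j : Fin m, μ (P ⁻¹' {itinerary T P m x j})) /
      μ (itinerary T P m ⁻¹' {itinerary T P m x}))
  have hmeas : ∀ m, Measurable (R m) := fun m =>
    (measurable_of_finite fun c : Fin m → ι => ENNReal.ofReal ((m : ℝ) ^ 2)⁻¹ *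
      ((∏ j : Fin m, μ (P ⁻¹' {c j})) / μ (itinerary T P m ⁻¹' {c}))).comp
        (measurable_itinerary hT hP m)
  have hsum : ∫⁻ x, ∑' m, R m x ∂μ ≠ ⊤ := by
    rw [lintegral_tsum fun m => (hmeas m).aemeasurable]
    refine ne_top_of_le_ne_top
      (Real.summable_nat_pow_inv.2 one_lt_two).tsum_ofReal_ne_top (ENNReal.tsum_le_tsum fun m => ?_)
    rw [lintegral_const_mul' _ _ ENNReal.ofReal_ne_top]
    exact mul_le_of_le_one_right' (lintegral_prod_div_measure_le_one hT hP m)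
  filter_upwards [ae_lt_top (Measurable.tsum hmeas) hsum] with x hx
  filter_upwards [(ENNReal.tendsto_atTop_zero_of_tsum_ne_top hx.ne).eventually_le_const one_pos]
    with m hm
  simp only [R, ← mul_div_assoc] at hm
  simpa using (ENNReal.div_le_iff_le_mul (Or.inr ENNReal.one_ne_top) (Or.inr one_ne_zero)).1 hm

/-- The exponential decay rate of the probability of an itinerary integrates to at most the
static entropy of the partition. -/
theorem lintegral_limsup_negLogNN_itinerary_le {μ : Measure X} [IsProbabilityMeasure μ]
    {T : X → X} (hT : MeasurePreserving T μ μ) {P : X → ι} (hP : Measurable P) :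
    ∫⁻ x, limsup (fun m : ℕ =>
      negLogNN (μ (itinerary T P m ⁻¹' {itinerary T P m x})) / m) atTop ∂μ ≤
      ENNReal.ofReal (partEnt μ P) := by
  let f : X → ℝ≥0∞ := fun x => ENNReal.ofReal (-Real.log (μ (P ⁻¹' {P x})).toReal)
  have hfmeas : Measurable f := (measurable_of_finite fun i =>
    ENNReal.ofReal (-Real.log (μ (P ⁻¹' {i})).toReal)).comp hP
  have hfbound : ∀ x, f x ≤ ∑ i, ENNReal.ofReal (-Real.log (μ (P ⁻¹' {i})).toReal) := fun x =>
    Finset.single_le_sum (f := fun i => ENNReal.ofReal (-Real.log (μ (P ⁻¹' {i})).toReal))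
      (fun _ _ => zero_le) (Finset.mem_univ (P x))
  have hf_ae : (fun x => negLogNN (μ (P ⁻¹' {P x}))) =ᵐ[μ] f := by
    filter_upwards [ae_measure_fiber_ne_zero μ hP] with x hx
    simp only [f, negLogNN, if_neg hx]
  have hsum_ae : ∀ᵐ x ∂μ, ∀ m : ℕ,
      birkhoffSum T (fun x => negLogNN (μ (P ⁻¹' {P x}))) m x = birkhoffSum T f m x :=
    ae_all_iff.2 fun m => hT.quasiMeasurePreserving.birkhoffSum_ae_eq_of_ae_eq hf_ae m
  calc _ ≤ ∫⁻ x, limsup (fun m : ℕ => birkhoffSum T f m x / m) atTop ∂μ := by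
        refine lintegral_mono_ae ?_
        filter_upwards [hsum_ae, ae_eventually_prod_le_measure hT.measurable hP] with x hx hev
        refine le_trans (limsup_le_limsup ?_)
          (ENNReal.limsup_add_of_left_tendsto_zero tendsto_negLogNN_inv_sq_div _).le
        filter_upwards [hev] with m hm
        rw [Pi.add_apply, ← ENNReal.add_div, ← hx m]
        refine ENNReal.div_le_div_right ?_ _
        refine (negLogNN_anti_s7 hm (measure_ne_top _ _)).trans ?_
        refine (negLogNN_mul_le ENNReal.ofReal_ne_top
          (ENNReal.prod_ne_top fun j _ => measure_ne_top _ _)).trans ?_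
        refine add_le_add le_rfl ((negLogNN_prod_le _ fun j => measure_ne_top _ _).trans_eq ?_)
        exact Fin.sum_univ_eq_sum_range (fun j => negLogNN (μ (P ⁻¹' {P (T^[j] x)}))) m
    _ ≤ ∫⁻ x, f x ∂μ := lintegral_limsup_birkhoffSum_le hT hfmeas
        (ENNReal.sum_ne_top.2 fun _ _ => ENNReal.ofReal_ne_top) hfbound
    _ = ENNReal.ofReal (partEnt μ P) := lintegral_ofReal_neg_log_eq_partEnt μ hP

end Entropy

lemma limsup_floor_div_le (b : ℕ → ℝ≥0∞) {s : ℝ} (hs : 0 < s) :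
    limsup (fun t : ℝ => b (⌊t / s⌋₊ + 1) / ENNReal.ofReal t) atTop ≤
      (ENNReal.ofReal s)⁻¹ * limsup (fun m : ℕ => b m / m) atTop := by
  have hfloor : Tendsto (fun t : ℝ => ⌊t / s⌋₊ + 1) atTop atTop :=
    (tendsto_add_atTop_nat 1).comp
      (tendsto_nat_floor_atTop.comp (tendsto_id.atTop_div_const hs))
  have hlim : Tendsto (fun t : ℝ => ENNReal.ofReal (s⁻¹ + t⁻¹)) atTop (𝓝 (ENNReal.ofReal s)⁻¹) := by
    rw [← ENNReal.ofReal_inv_of_pos hs]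
    simpa using ENNReal.tendsto_ofReal (tendsto_const_nhds.add tendsto_inv_atTop_zero)
  have hs0 : (ENNReal.ofReal s)⁻¹ ≠ 0 := ENNReal.inv_ne_zero.2 ENNReal.ofReal_ne_top
  have hs_fin : (ENNReal.ofReal s)⁻¹ ≠ ⊤ := ENNReal.inv_ne_top.2 (ENNReal.ofReal_pos.2 hs).ne'
  calc _ ≤ limsup ((fun t : ℝ => ENNReal.ofReal (s⁻¹ + t⁻¹)) *
        ((fun m : ℕ => b m / m) ∘ fun t : ℝ => ⌊t / s⌋₊ + 1)) atTop := by
        refine limsup_le_limsup ?_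
        filter_upwards [eventually_gt_atTop 0] with t ht
        rw [Pi.mul_apply, Function.comp_apply]
        set n := ⌊t / s⌋₊ + 1 with hn
        have hn0 : (n : ℝ≥0∞) ≠ 0 := by simp [hn]
        have hnt := ENNReal.natCast_ne_top n
        have hle : (n : ℝ≥0∞) / ENNReal.ofReal t ≤ ENNReal.ofReal (s⁻¹ + t⁻¹) := by
          rw [← ENNReal.ofReal_natCast n, ← ENNReal.ofReal_div_of_pos ht]
          refine ENNReal.ofReal_le_ofReal ?_
          rw [div_le_iff₀ ht, add_mul, inv_mul_cancel₀ ht.ne', hn, Nat.cast_add, Nat.cast_one,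
            inv_mul_eq_div]
          gcongr
          exact Nat.floor_le (by positivity)
        calc b n / ENNReal.ofReal t = (n : ℝ≥0∞) * (b n / n) / ENNReal.ofReal t := by
              rw [ENNReal.mul_div_cancel hn0 hnt]
          _ = (n : ℝ≥0∞) / ENNReal.ofReal t * (b n / n) := ENNReal.mul_div_right_comm
          _ ≤ _ := by gcongr
    _ ≤ limsup (fun t : ℝ => ENNReal.ofReal (s⁻¹ + t⁻¹)) atTop *
        limsup ((fun m : ℕ => b m / m) ∘ fun t : ℝ => ⌊t / s⌋₊ + 1) atTop :=
        ENNReal.limsup_mul_le' (Or.inl (by rwa [hlim.limsup_eq]))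
          (Or.inl (by rwa [hlim.limsup_eq]))
    _ ≤ _ := by
        rw [hlim.limsup_eq, limsup_comp]
        gcongr
        exact limsup_le_limsup_of_le hfloor

lemma iterate_flow [TopologicalSpace X] {φ : ℝ → X → X} (hφ : IsFlow φ) (τ : ℝ) (n : ℕ) (x : X) :
    (φ τ)^[n] x = φ (n * τ) x := by
  induction n with
  | zero => simp [hφ.map_zero]
  | succ n ih =>
    rw [Function.iterate_succ_apply', ih, ← hφ.map_add]
    push_cast
    ring_nf

/-- Iterates agree through `P` for `m * N` steps when the blocked itineraries agree. -/
lemma eq_of_itinerary_itinerary_eq {ι : Type*} {T : X → X} {P : X → ι} {m N : ℕ} {x y : X}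
    (h : itinerary T^[N] (itinerary T P N) m y = itinerary T^[N] (itinerary T P N) m x)
    {i : ℕ} (hi : i < m * N) : P (T^[i] y) = P (T^[i] x) := by
  have hN : 0 < N := Nat.pos_of_ne_zero fun h0 => by simp [h0] at hi
  have hblock := congrFun (congrFun h ⟨i / N, Nat.div_lt_of_lt_mul (by rwa [mul_comm])⟩)
    ⟨i % N, Nat.mod_lt _ hN⟩
  simpa only [itinerary, ← Function.iterate_mul, ← Function.iterate_add_apply,
    Nat.mod_add_div] using hblock

section DynBall

/-- The closed Bowen ball of radius `ε` over the time interval `[0, t)`. -/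
def dynBall [PseudoMetricSpace X] (φ : ℝ → X → X) (x : X) (t ε : ℝ) : Set X :=
  {y : X | ∀ s ∈ Ico 0 t, dist (φ s x) (φ s y) ≤ ε}

lemma dynBall_mono [PseudoMetricSpace X] (φ : ℝ → X → X) (x : X) {t t' ε ε' : ℝ}
    (ht : t' ≤ t) (hε : ε ≤ ε') : dynBall φ x t ε ⊆ dynBall φ x t' ε' :=
  fun _ hy s hs => (hy s ⟨hs.1, hs.2.trans_le ht⟩).trans hε

lemma dynBall_subset_reparBall [PseudoMetricSpace X] (φ : ℝ → X → X) (x : X) {t t' ε ε' : ℝ}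
    (ht : t' < t) (hε : ε < ε') : dynBall φ x t ε ⊆ reparBall φ x t' ε' :=
  fun _ hy => ⟨id, ⟨continuousOn_id, injOn_id _, rfl⟩,
    fun s hs => (hy s ⟨hs.1, hs.2.trans_lt ht⟩).trans_lt hε⟩

/-- Points whose `φ τ`-orbits visit the same cells of a partition that controls the flow up to
time `τ` lie in a common dynamical ball. -/
lemma mem_dynBall_of_forall_eq [PseudoMetricSpace X] {φ : ℝ → X → X} (hφ : IsFlow φ) {τ ε : ℝ}
    (hτ : 0 < τ) {ι : Type*} {P : X → ι}
    (hP : ∀ x y, P x = P y → ∀ s ∈ Icc 0 τ, dist (φ s x) (φ s y) ≤ ε) {n : ℕ} {x y : X}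
    (h : ∀ i < n, P ((φ τ)^[i] y) = P ((φ τ)^[i] x)) : y ∈ dynBall φ x (n * τ) ε := by
  intro s hs
  have hdiv : 0 ≤ s / τ := div_nonneg hs.1 hτ.le
  have hi : ⌊s / τ⌋₊ < n := (Nat.floor_lt hdiv).2 ((div_lt_iff₀ hτ).2 hs.2)
  have hle : ⌊s / τ⌋₊ * τ ≤ s := (le_div_iff₀ hτ).1 (Nat.floor_le hdiv)
  have hlt : s < (⌊s / τ⌋₊ + 1) * τ := (div_lt_iff₀ hτ).1 (Nat.lt_floor_add_one _)
  have key := hP _ _ (h _ hi).symm (s - ⌊s / τ⌋₊ * τ) ⟨by linarith, by linarith⟩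
  simpa only [iterate_flow hφ, ← hφ.map_add, sub_add_cancel] using key

variable [MetricSpace X] [CompactSpace X] [MeasurableSpace X] [BorelSpace X]

lemma measurable_measure_dynBall {φ : ℝ → X → X} (hφ : IsFlow φ) (μ : Measure X) [SFinite μ]
    (t ε : ℝ) : Measurable fun x => μ (dynBall φ x t ε) := by
  have : SecondCountableTopology X := EMetric.secondCountable_of_sigmaCompact X
  have hcont : ∀ s, Continuous (φ s) := fun s => hφ.cont.comp (Continuous.prodMk_right s)
  have hclosed : IsClosed {p : X × X | ∀ s ∈ Ico 0 t, dist (φ s p.1) (φ s p.2) ≤ ε} := by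
    simp only [ofPred_forall]
    exact isClosed_biInter fun s _ => isClosed_le
      (((hcont s).comp continuous_fst).dist ((hcont s).comp continuous_snd)) continuous_const
  exact measurable_measure_prodMk_left hclosed.measurableSet

/-- A finite measurable partition whose cells stay `ε`-close under the flow up to time `τ`. -/
lemma exists_partition_dist_flow_le {φ : ℝ → X → X} (hφ : IsFlow φ) (τ : ℝ) {ε : ℝ}
    (hε : 0 < ε) : ∃ (k : ℕ) (P : X → Fin k), Measurable P ∧
      ∀ x y, P x = P y → ∀ s ∈ Icc 0 τ, dist (φ s x) (φ s y) ≤ ε := by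
  classical
  obtain ⟨δ, hδ, hunif⟩ := Metric.uniformContinuousOn_iff.1
    ((isCompact_Icc.prod isCompact_univ).uniformContinuousOn_of_continuous
      (s := Icc 0 τ ×ˢ (univ : Set X)) hφ.cont.continuousOn) ε hε
  obtain ⟨t, -, htfin, htcover⟩ := finite_cover_balls_of_compact (isCompact_univ (X := X))
    (half_pos hδ)
  have := htfin.fintype
  let C : X → t → Bool := fun x c => decide (x ∈ Metric.ball (c : X) (δ / 2))
  have hC : Measurable C := measurable_pi_lambda _ fun c =>
    measurable_to_bool <| by
      have hpre : (fun x => C x c) ⁻¹' {true} = Metric.ball (c : X) (δ / 2) := by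
        ext x
        simp only [C, mem_preimage, mem_singleton_iff, decide_eq_true_eq]
      exact hpre ▸ Metric.isOpen_ball.measurableSet
  refine ⟨_, Fintype.equivFin (t → Bool) ∘ C, (measurable_of_finite _).comp hC,
    fun x y hxy s hs => ?_⟩
  have hCxy : C x = C y := (Fintype.equivFin (t → Bool)).injective hxy
  obtain ⟨c, hc, hxc⟩ := mem_iUnion₂.1 (htcover (mem_univ x))
  have hyc : y ∈ Metric.ball c (δ / 2) := by
    have := congrFun hCxy ⟨c, hc⟩
    simpa [C, Metric.mem_ball.1 hxc] using this
  have hdist : dist x y < δ := by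
    linarith [dist_triangle_right x y c, Metric.mem_ball.1 hxc, Metric.mem_ball.1 hyc]
  exact (hunif (s, x) ⟨hs, mem_univ _⟩ (s, y) ⟨hs, mem_univ _⟩
    (by simp [Prod.dist_eq, hdist])).le

end DynBall

section KolSinai

variable [MeasurableSpace X]

lemma partEnt_itinerary_eq_of_inverse {μ : Measure X} {T T' : X → X} {ι : Type*} [Fintype ι]
    [MeasurableSpace ι] [MeasurableSingletonClass ι] (hT : Measurable T)
    (hT' : MeasurePreserving T' μ μ) (hinv : Function.LeftInverse T T') {P : X → ι}
    (hP : Measurable P) (n : ℕ) :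
    partEnt μ (itinerary T' P n) = partEnt μ (itinerary T P n) := by
  have hrev : Function.Involutive fun c : Fin n → ι => c ∘ Fin.rev := fun c => by
    ext j; simp
  refine (Fintype.sum_equiv hrev.toPerm _ _ fun c => ?_).symm
  have hset : itinerary T' P n ⁻¹' {c ∘ Fin.rev} = T'^[n - 1] ⁻¹' (itinerary T P n ⁻¹' {c}) := by
    have hitin : ∀ x, itinerary T P n (T'^[n - 1] x) = itinerary T' P n x ∘ Fin.rev := fun x => by
      ext j
      have hj : n - 1 = j + (n - (j + 1)) := by omega
      simp only [itinerary, Function.comp_apply, Fin.val_rev]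
      rw [hj, Function.iterate_add_apply, hinv.iterate]
    ext x
    simp only [mem_preimage, mem_singleton_iff, hitin]
    exact ⟨fun h => by rw [h]; exact hrev c, fun h => by rw [← h]; exact (hrev _).symm⟩
  change _ = Real.negMulLog (μ (itinerary T' P n ⁻¹' {c ∘ Fin.rev})).toReal
  rw [hset, (hT'.iterate _).measure_preimage
    (measurable_itinerary hT hP n (measurableSet_singleton c)).nullMeasurableSet]

lemma kolSinai_eq_of_inverse {μ : Measure X} {T T' : X → X} (hT : Measurable T)
    (hT' : MeasurePreserving T' μ μ) (hinv : Function.LeftInverse T T') :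
    kolSinai μ T' = kolSinai μ T := by
  refine iSup_congr fun k => iSup_congr fun P => iSup_congr fun hP => limsup_congr ?_
  exact Eventually.of_forall fun n => congrArg (fun r => ENNReal.ofReal (r / n))
    (partEnt_itinerary_eq_of_inverse hT hT' hinv hP n)

lemma le_kolSinai {μ : Measure X} {T : X → X} {k : ℕ} {P : X → Fin k} (hP : Measurable P)
    {a : ℝ≥0∞} (h : ∀ n : ℕ, 1 ≤ n → a ≤ ENNReal.ofReal (partEnt μ (itinerary T P n) / n)) :
    a ≤ kolSinai μ T := by
  refine le_iSup_of_le k (le_iSup_of_le P (le_iSup_of_le hP ?_))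
  refine le_limsup_of_frequently_le (Eventually.frequently ?_)
  filter_upwards [eventually_ge_atTop 1] with n hn using h n hn

end KolSinai

section Main

variable [MetricSpace X]

lemma upperLocalEnt_le_iSup_dynBall [MeasurableSpace X] (μ : Measure X) [IsFiniteMeasure μ]
    (φ : ℝ → X → X) (x : X) {τ : ℝ} (hτ : 0 < τ) :
    upperLocalEnt μ φ x ≤ (ENNReal.ofReal τ)⁻¹ * ⨆ k : ℕ,
      limsup (fun n : ℕ => negLogNN (μ (dynBall φ x (n * τ) (1 / (k + 1)))) / n) atTop := by
  refine iSup₂_le fun ε hε => ?_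
  obtain ⟨k, hk⟩ := exists_nat_one_div_lt hε
  refine le_trans ?_ (mul_le_mul_right (le_iSup _ k) _)
  refine le_trans (limsup_le_limsup (Eventually.of_forall fun t => ?_))
    (limsup_floor_div_le (fun n => negLogNN (μ (dynBall φ x (n * τ) (1 / (k + 1))))) hτ)
  refine ENNReal.div_le_div_right (negLogNN_anti_s7 (measure_mono ?_) (measure_ne_top _ _)) _
  refine dynBall_subset_reparBall φ x ?_ hk
  rw [← div_lt_iff₀ hτ, Nat.cast_add, Nat.cast_one]
  exact Nat.lt_floor_add_one _

variable [CompactSpace X] [MeasurableSpace X] [BorelSpace X]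

lemma lintegral_limsup_dynBall_le_kolSinai {φ : ℝ → X → X} (hφ : IsFlow φ) {μ : Measure X}
    [IsProbabilityMeasure μ] {τ : ℝ} (hτ : 0 < τ) (hT : MeasurePreserving (φ τ) μ μ) {ε : ℝ}
    (hε : 0 < ε) :
    ∫⁻ x, limsup (fun n : ℕ => negLogNN (μ (dynBall φ x (n * τ) ε)) / n) atTop ∂μ ≤
      kolSinai μ (φ τ) := by
  obtain ⟨k, P, hPmeas, hP⟩ := exists_partition_dist_flow_le hφ τ hε
  refine le_kolSinai hPmeas fun N hN => ?_
  have hN0 : (0 : ℝ) < N := by exact_mod_cast hN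
  have hNinv : (ENNReal.ofReal N)⁻¹ ≠ ⊤ := ENNReal.inv_ne_top.2 (ENNReal.ofReal_pos.2 hN0).ne'
  let Q := itinerary (φ τ) P N
  have hQ : Measurable Q := measurable_itinerary hT.measurable hPmeas N
  let b : X → ℕ → ℝ≥0∞ := fun x m =>
    negLogNN (μ (itinerary (φ τ)^[N] Q m ⁻¹' {itinerary (φ τ)^[N] Q m x}))
  have hpt : ∀ x, limsup (fun n : ℕ => negLogNN (μ (dynBall φ x (n * τ) ε)) / n) atTop ≤
      (ENNReal.ofReal N)⁻¹ * limsup (fun m : ℕ => b x m / m) atTop := fun x => by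
    calc _ ≤ limsup ((fun t : ℝ => b x (⌊t / N⌋₊ + 1) / ENNReal.ofReal t) ∘
          fun n : ℕ => (n : ℝ)) atTop := by
          refine limsup_le_limsup (Eventually.of_forall fun n => ?_)
          rw [Function.comp_apply, ENNReal.ofReal_natCast]
          refine ENNReal.div_le_div_right (negLogNN_anti_s7 (measure_mono fun y hy => ?_)
            (measure_ne_top _ _)) _
          have hn : (n : ℝ) ≤ ((⌊(n : ℝ) / N⌋₊ + 1) * N : ℕ) := by
            push_cast
            rw [← div_le_iff₀ hN0]
            exact (Nat.lt_floor_add_one _).le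
          exact dynBall_mono φ x (mul_le_mul_of_nonneg_right hn hτ.le) le_rfl
            (mem_dynBall_of_forall_eq hφ hτ hP fun i hi => eq_of_itinerary_itinerary_eq hy hi)
      _ ≤ limsup (fun t : ℝ => b x (⌊t / N⌋₊ + 1) / ENNReal.ofReal t) atTop := by
          rw [limsup_comp]
          exact limsup_le_limsup_of_le tendsto_natCast_atTop_atTop
      _ ≤ _ := limsup_floor_div_le (b x) hN0
  calc _ ≤ ∫⁻ x, (ENNReal.ofReal N)⁻¹ * limsup (fun m : ℕ => b x m / m) atTop ∂μ :=
        lintegral_mono hpt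
    _ = (ENNReal.ofReal N)⁻¹ * ∫⁻ x, limsup (fun m : ℕ => b x m / m) atTop ∂μ :=
        lintegral_const_mul' _ _ hNinv
    _ ≤ (ENNReal.ofReal N)⁻¹ * ENNReal.ofReal (partEnt μ Q) := by
        gcongr
        exact lintegral_limsup_negLogNN_itinerary_le (hT.iterate N) hQ
    _ = ENNReal.ofReal (partEnt μ Q / N) := by
        rw [ENNReal.ofReal_div_of_pos hN0, ENNReal.div_eq_inv_mul]

theorem lintegral_upperLocalEnt_le_of_pos {φ : ℝ → X → X} (hφ : IsFlow φ) {μ : Measure X}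
    [IsProbabilityMeasure μ] {τ : ℝ} (hτ : 0 < τ) (hT : MeasurePreserving (φ τ) μ μ) :
    ∫⁻ x, upperLocalEnt μ φ x ∂μ ≤ (ENNReal.ofReal τ)⁻¹ * kolSinai μ (φ τ) := by
  let v : ℕ → X → ℝ≥0∞ := fun k x =>
    limsup (fun n : ℕ => negLogNN (μ (dynBall φ x (n * τ) (1 / (k + 1)))) / n) atTop
  have hvmeas : ∀ k, Measurable (v k) := fun k => Measurable.limsup fun n =>
    (measurable_negLogNN.comp (measurable_measure_dynBall hφ μ _ _)).div_const _
  have hvmono : Monotone v := fun k l hkl x => limsup_le_limsup <| Eventually.of_forall fun n =>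
    ENNReal.div_le_div_right (negLogNN_anti_s7 (measure_mono (dynBall_mono φ x le_rfl
      (Nat.one_div_le_one_div hkl))) (measure_ne_top _ _)) _
  calc _ ≤ ∫⁻ x, (ENNReal.ofReal τ)⁻¹ * ⨆ k, v k x ∂μ :=
        lintegral_mono fun x => upperLocalEnt_le_iSup_dynBall μ φ x hτ
    _ = (ENNReal.ofReal τ)⁻¹ * ⨆ k, ∫⁻ x, v k x ∂μ := by
        rw [lintegral_const_mul _ (Measurable.iSup hvmeas), lintegral_iSup hvmeas hvmono]
    _ ≤ _ := by
        gcongr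
        exact iSup_le fun k =>
          lintegral_limsup_dynBall_le_kolSinai hφ hτ hT Nat.one_div_pos_of_nat

end Main

/-- **Proposition.** For a compact metric flow `φ` and a `φ`-invariant Borel probability
measure `μ`, for every `τ ≠ 0`,
`∫ overline h_μ(φ, x) dμ(x) ≤ (1/|τ|) h_μ(φ_τ)`. -/
theorem lintegral_upperLocalEnt_le {X : Type*} [MetricSpace X] [CompactSpace X]
    [MeasurableSpace X] [BorelSpace X] (φ : ℝ → X → X) (hφ : IsFlow φ)
    (μ : Measure X) [IsProbabilityMeasure μ] (hinv : FlowInvariant φ μ)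
    (τ : ℝ) (hτ : τ ≠ 0) :
    ∫⁻ x, upperLocalEnt μ φ x ∂μ ≤ (ENNReal.ofReal |τ|)⁻¹ * kolSinai μ (φ τ) := by
  have hent : kolSinai μ (φ |τ|) = kolSinai μ (φ τ) := by
    rcases abs_choice τ with h | h
    · rw [h]
    · rw [h]
      refine kolSinai_eq_of_inverse (hinv τ).measurable (hinv (-τ)) fun x => ?_
      rw [← hφ.map_add, add_neg_cancel, hφ.map_zero]
  rw [← hent]
  exact lintegral_upperLocalEnt_le_of_pos hφ (abs_pos.2 hτ) (hinv |τ|)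

end FlowEntropy
end
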